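/- L^1-L^2 inhomogeneous estimate: for n ∈ ℕ, 2 ≤ p < 2*, and I = [0,T), the operator A_S f(t) = ∫_0^t e^{i(t−τ)Δ} f(τ)dτ satisfies ‖A_S f‖_{L^{γ(p)}(I, L^{p,2})} ≲ ‖f‖_{L^1(I, L^2(ℝ^n))}. -/

import Mathlib

open MeasureTheory ENNReal Set Filter

noncomputable section

abbrev Rn (n : ℕ) := EuclideanSpace ℝ (Fin n)

/-- Decreasing rearrangement of `f` with respect to `μ`. -/
def rearrangement {α : Type*} [MeasurableSpace α] (μ : Measure α)
    {E : Type*} [NNNorm E] (f : α → E) (t : ℝ) : ℝ≥0∞ :=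
  sInf {l : ℝ≥0∞ | μ {x | l < (‖f x‖₊ : ℝ≥0∞)} ≤ ENNReal.ofReal t}

/-- Lorentz quasinorm `‖f‖_{L^{p,q}}` defined via the decreasing rearrangement. -/
def lorentzNorm {α : Type*} [MeasurableSpace α] {E : Type*} [NNNorm E]
    (μ : Measure α) (p q : ℝ≥0∞) (f : α → E) : ℝ≥0∞ :=
  if q = ∞ then ⨆ t ∈ Ioi (0:ℝ), ENNReal.ofReal (t ^ p.toReal⁻¹) * rearrangement μ f t
  else (∫⁻ t in Ioi (0:ℝ),
      (ENNReal.ofReal (t ^ p.toReal⁻¹) * rearrangement μ f t) ^ q.toReal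
        * ENNReal.ofReal t⁻¹) ^ q.toReal⁻¹

/-- `‖f‖_{L^{p,2}(ℝ^n)}`. -/
def lornorm (n : ℕ) (p : ℝ) (f : Rn n → ℂ) : ℝ≥0∞ :=
  lorentzNorm volume (ENNReal.ofReal p) 2 f

/-- The free Schrödinger propagator `e^{itΔ}` on `ℝ^n`, given by convolution with
`(4πit)^{-n/2} e^{i|x|²/(4t)}`. -/
def schrodinger (n : ℕ) (t : ℝ) (f : Rn n → ℂ) : Rn n → ℂ := fun x =>
  (4 * (Real.pi : ℂ) * Complex.I * (t : ℂ)) ^ (-(n : ℂ) / 2) *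
    ∫ y : Rn n, Complex.exp (Complex.I * ((‖x - y‖ : ℂ)) ^ 2 / (4 * (t : ℂ))) * f y

/-- The Strichartz exponent `γ(p)` with `1/γ(p) = (n/2)(1/2 - 1/p)` (so `γ(2) = ∞`). -/
def gam (n : ℕ) (p : ℝ) : ℝ≥0∞ := (ENNReal.ofReal ((n / 2 : ℝ) * (1/2 - 1/p)))⁻¹

/-- Hölder conjugate of an extended-real exponent. -/
def conjE (p : ℝ≥0∞) : ℝ≥0∞ := (1 - p⁻¹)⁻¹

/-- Mixed space-time norm `‖f‖_{L^γ(I, X)}` given the map `t ↦ ‖f(t)‖_X`. -/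
def timeNorm (γ : ℝ≥0∞) (I : Set ℝ) (N : ℝ → ℝ≥0∞) : ℝ≥0∞ :=
  if γ = ∞ then essSup N (volume.restrict I)
  else (∫⁻ t in I, N t ^ γ.toReal) ^ γ.toReal⁻¹

/-- `2 ≤ p < 2*` where `2* = 2n/(n-2)` for `n ≥ 3` and `2* = ∞` for `n = 1, 2`. -/
def subcrit (n : ℕ) (p : ℝ) : Prop := 2 ≤ p ∧ (3 ≤ n → p < 2 * n / (n - 2))

/-- Duhamel operator `A_S f (t) = ∫_{t₀}^t e^{i(t-τ)Δ} f(τ) dτ`. -/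
def duhamel (n : ℕ) (t₀ : ℝ) (f : ℝ → Rn n → ℂ) (t : ℝ) : Rn n → ℂ :=
  fun x => ∫ τ in t₀..t, schrodinger n (t - τ) (f τ) x

/-- The inhomogeneous nonlinearity `|x|^{-b} |u|^σ u`. -/
def nonlin (n : ℕ) (b σ : ℝ) (u : Rn n → ℂ) : Rn n → ℂ := fun x =>
  Complex.ofReal (‖x‖ ^ (-b)) * (Complex.ofReal (‖u x‖ ^ σ) * u x)

/-- Laplacian on `ℝ^n` of a complex-valued function. -/
def lap (n : ℕ) (f : Rn n → ℂ) (x : Rn n) : ℂ :=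
  ∑ i : Fin n, fderiv ℝ (fun y => fderiv ℝ f y (EuclideanSpace.single i 1)) x
    (EuclideanSpace.single i 1)

/-- `u` solves `i ∂_t u + Δ u = λ |x|^{-b} |u|^σ u` classically away from `x = 0`. -/
def solvesINLS (n : ℕ) (b σ : ℝ) (lam : ℂ) (u : ℝ → Rn n → ℂ) : Prop :=
  ∀ t : ℝ, ∀ x : Rn n, x ≠ 0 →
    Complex.I * deriv (fun s => u s x) t + lap n (u t) x =
      lam * Complex.ofReal (‖x‖ ^ (-b)) * (Complex.ofReal (‖u t x‖ ^ σ) * u t x)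

/-- Peetre K-functional for the couple `(L²(ℝ^n), L^r(ℝ^n))`. -/
def Kfun (n : ℕ) (r : ℝ) (t : ℝ) (f : Rn n → ℂ) : ℝ≥0∞ :=
  ⨅ g : Rn n → ℂ,
    eLpNorm g 2 volume + ENNReal.ofReal t * eLpNorm (f - g) (ENNReal.ofReal r) volume

/-- Real interpolation norm for `(L², L^r)_{θ,2}` by the K-method. -/
def interpNorm (n : ℕ) (r θ : ℝ) (f : Rn n → ℂ) : ℝ≥0∞ :=
  (∫⁻ t in Ioi (0:ℝ), (ENNReal.ofReal (t ^ (-θ)) * Kfun n r t f) ^ (2:ℝ)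
    * ENNReal.ofReal t⁻¹) ^ ((2:ℝ)⁻¹)

/-- `u` is a solution of the Duhamel equation for INLS with data `u₀` on the time set `I`,
belonging to `L^{γ(r)}(I, L^{r,2})`. -/
def IsSolOn (n : ℕ) (b σ r : ℝ) (lam : ℂ) (u₀ : Rn n → ℂ) (I : Set ℝ)
    (u : ℝ → Rn n → ℂ) : Prop :=
  Measurable (fun q : ℝ × Rn n => u q.1 q.2) ∧
  timeNorm (gam n r) I (fun t => lornorm n r (u t)) < ∞ ∧
  ∀ t ∈ I, ∀ᵐ x : Rn n ∂volume, u t x = schrodinger n t u₀ x -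
    Complex.I * lam * duhamel n 0 (fun τ => nonlin n b σ (u τ)) t x

end

section

open scoped FourierTransform ComplexConjugate RealInnerProductSpace Topology

/-- The Hilbert space `L²(ℝⁿ)`. -/
noncomputable abbrev L2 (n : ℕ) := Lp (α := Rn n) ℂ 2 volume

/-- On `L¹ ∩ L²` the Plancherel extension of the Fourier transform is the Fourier integral. -/
lemma coeFn_fourier_toLp {n : ℕ} {f : Rn n → ℂ} (h₁ : Integrable f) (h₂ : MemLp f 2) :
    ⇑(𝓕 (h₂.toLp f) : L2 n) =ᵐ[volume] 𝓕 f := by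
  apply ae_eq_of_integral_contDiff_smul_eq
  · exact (Lp.memLp _).locallyIntegrable one_le_two
  · exact (VectorFourier.fourierIntegral_continuous Real.continuous_fourierChar
      (by exact continuous_inner) h₁).locallyIntegrable
  intro g g_smooth g_cpt
  have hg₁ : HasCompactSupport (Complex.ofRealCLM ∘ g) := g_cpt.comp_left rfl
  have hg₂ : ContDiff ℝ (⊤ : ℕ∞) (Complex.ofRealCLM ∘ g) := by fun_prop
  set φ : SchwartzMap (Rn n) ℂ := hg₁.toSchwartzMap hg₂
  have hφ : ∀ x, φ x = (g x : ℂ) := fun x => rfl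
  have e1 : ∫ x, g x • (𝓕 (h₂.toLp f) : L2 n) x = ∫ x, (𝓕 φ) x • f x := by
    have := congrArg (fun D : TemperedDistribution (Rn n) ℂ => D φ)
      (Lp.fourier_toTemperedDistribution_eq (h₂.toLp f))
    simp only [TemperedDistribution.fourier_apply, Lp.toTemperedDistribution_apply] at this
    simp only [hφ] at this
    have e : ∀ x, g x • (𝓕 (h₂.toLp f) : L2 n) x = (g x : ℂ) • (𝓕 (h₂.toLp f) : L2 n) x := by
      intro x; simp
    simp_rw [e]
    rw [← this]
    apply integral_congr_ae
    filter_upwards [h₂.coeFn_toLp] with x hx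
    rw [hx]
  rw [e1]
  have := VectorFourier.integral_fourierIntegral_smul_eq_flip (L := innerₗ (Rn n)) (μ := volume)
    (ν := volume) (f := φ) (g := f) Real.continuous_fourierChar (by exact continuous_inner) φ.integrable h₁
  rw [flip_innerₗ] at this
  rw [SchwartzMap.fourier_coe]
  refine this.trans (integral_congr_ae (.of_forall fun x => ?_))
  simp only [hφ]
  simp only [smul_eq_mul, Complex.real_smul]
  rfl

lemma integrable_gaussian {n : ℕ} {b : ℂ} (hb : 0 < b.re) :
    Integrable (fun ξ : Rn n => Complex.exp (-b * (‖ξ‖ : ℂ) ^ 2)) := by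
  simpa using GaussianFourier.integrable_cexp_neg_mul_sq_norm_add (V := Rn n) hb 0 0

lemma conj_fourier {n : ℕ} (f : Rn n → ℂ) (ξ : Rn n) :
    conj (𝓕 f ξ) = 𝓕⁻ (fun x => conj (f x)) ξ := by
  rw [Real.fourier_eq', Real.fourierInv_eq', ← integral_conj]
  congr 1
  ext y
  simp [← Complex.exp_conj, Complex.conj_ofNat]

lemma continuous_fourier_of_integrable {n : ℕ} {f : Rn n → ℂ} (hf : Integrable f) :
    Continuous (𝓕 f) :=
  VectorFourier.fourierIntegral_continuous Real.continuous_fourierChar (by exact continuous_inner) hf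

lemma continuous_fourierInv_of_integrable {n : ℕ} {f : Rn n → ℂ} (hf : Integrable f) :
    Continuous (𝓕⁻ f) := by
  rw [Real.fourierInv_eq_fourier_comp_neg]
  exact continuous_fourier_of_integrable hf.comp_neg

lemma norm_fourierInv_le {n : ℕ} (f : Rn n → ℂ) (ξ : Rn n) : ‖𝓕⁻ f ξ‖ ≤ ∫ x, ‖f x‖ := by
  rw [Real.fourierInv_eq_fourier_neg]
  exact VectorFourier.norm_fourierIntegral_le_integral_norm _ _ _ _ _

lemma integral_fourier_mul_flip {n : ℕ} {f g : Rn n → ℂ} (hf : Integrable f) (hg : Integrable g) :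
    ∫ ξ, 𝓕 f ξ * g ξ = ∫ x, f x * 𝓕 g x := by
  have := VectorFourier.integral_fourierIntegral_smul_eq_flip (L := innerₗ (Rn n)) (μ := volume)
    (ν := volume) (f := f) (g := g) Real.continuous_fourierChar (by exact continuous_inner) hf hg
  rw [flip_innerₗ] at this
  exact this

/-- Parseval identity with a Gaussian weight: the weight turns into convolution by a Gaussian. -/
lemma integral_gaussian_mul_conj_fourier_mul_fourier {n : ℕ} {b : ℂ} (hb : 0 < b.re)
    {f h : Rn n → ℂ} (hf : Integrable f) (hh : Integrable h) :
    ∫ ξ, Complex.exp (-b * (‖ξ‖ : ℂ) ^ 2) * (conj (𝓕 f ξ) * 𝓕 h ξ) =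
      ∫ x, (∫ y, (Real.pi / b) ^ (n / 2 : ℂ) *
        Complex.exp (-Real.pi ^ 2 * (‖x - y‖ : ℂ) ^ 2 / b) * conj (f y)) * h x := by
  have hcf : Integrable (fun x => conj (f x)) := by
    simpa using (Complex.conjLIE.toContinuousLinearEquiv.integrable_comp_iff).2 hf
  set F := 𝓕⁻ (fun x => conj (f x)) with hF
  have hG : Integrable (fun ξ : Rn n => Complex.exp (-b * (‖ξ‖ : ℂ) ^ 2) * F ξ) :=
    (integrable_gaussian hb).mul_bdd
      (continuous_fourierInv_of_integrable hcf).aestronglyMeasurable (.of_forall (norm_fourierInv_le _))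
  calc _ = ∫ ξ, 𝓕 h ξ * (Complex.exp (-b * (‖ξ‖ : ℂ) ^ 2) * F ξ) := by
        congr 1; ext ξ; rw [conj_fourier]; ring
    _ = ∫ x, h x * 𝓕 (fun ξ : Rn n => Complex.exp (-b * (‖ξ‖ : ℂ) ^ 2) * F ξ) x :=
        integral_fourier_mul_flip hh hG
    _ = _ := by
        congr 1; ext x
        rw [mul_comm]
        congr 1
        have hg : Integrable (fun ξ : Rn n => Complex.exp (-b * (‖ξ‖ : ℂ) ^ 2 +
            2 * Real.pi * Complex.I * (⟪x, ξ⟫ : ℝ))) := by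
          exact GaussianFourier.integrable_cexp_neg_mul_sq_norm_add hb (2 * Real.pi * Complex.I) x
        have := integral_fourier_mul_flip hcf hg
        simp_rw [fourier_gaussian_innerProductSpace' hb] at this
        have e : 𝓕 (fun ξ : Rn n => Complex.exp (-b * (‖ξ‖ : ℂ) ^ 2) * F ξ) x =
            ∫ ξ, 𝓕 (fun x => conj (f x)) ξ * Complex.exp (-b * (‖ξ‖ : ℂ) ^ 2 +
            2 * Real.pi * Complex.I * (⟪x, ξ⟫ : ℝ)) := by
          rw [Real.fourier_eq', ← integral_neg_eq_self]
          congr 1; ext ξ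
          rw [hF, Real.fourierInv_eq_fourier_neg, neg_neg]
          simp only [norm_neg, inner_neg_left, smul_eq_mul, Complex.exp_add]
          rw [real_inner_comm]
          push_cast
          ring_nf
        rw [e, this]
        congr 1; ext y
        simp
        ring

lemma norm_cexp_neg_div_le_one {b : ℂ} (hb : 0 ≤ b.re) (s : ℝ) :
    ‖Complex.exp (-Real.pi ^ 2 * (s : ℂ) ^ 2 / b)‖ ≤ 1 := by
  rw [Complex.norm_exp, Real.exp_le_one_iff]
  have : (-Real.pi ^ 2 * (s : ℂ) ^ 2 / b) = ((-(Real.pi ^ 2 * s ^ 2) : ℝ) : ℂ) * b⁻¹ := by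
    push_cast; ring
  rw [this, Complex.re_ofReal_mul, Complex.inv_re]
  have : 0 ≤ Real.pi ^ 2 * s ^ 2 * (b.re / Complex.normSq b) :=
    mul_nonneg (by positivity) (div_nonneg hb (Complex.normSq_nonneg _))
  linarith

lemma arg_ofReal_mul_I_ne_pi (a : ℝ) : ((a : ℂ) * Complex.I).arg ≠ Real.pi := by
  simp [Complex.arg_eq_pi_iff]

lemma conj_schrodinger_const (n : ℕ) {r : ℝ} (hr : r ≠ 0) :
    ((Real.pi : ℂ) / (-(4 * Real.pi ^ 2 * r : ℝ) * Complex.I)) ^ (n / 2 : ℂ) =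
      conj ((4 * (Real.pi : ℂ) * Complex.I * (r : ℂ)) ^ (-(n : ℂ) / 2)) := by
  have hz : (4 * (Real.pi : ℂ) * Complex.I * (r : ℂ)) = ((4 * Real.pi * r : ℝ) : ℂ) * Complex.I := by
    push_cast; ring
  have hcz : conj (4 * (Real.pi : ℂ) * Complex.I * (r : ℂ)) =
      ((-(4 * Real.pi * r) : ℝ) : ℂ) * Complex.I := by
    rw [hz]; simp [Complex.conj_ofNat]
  have e1 : ((Real.pi : ℂ) / (-(4 * Real.pi ^ 2 * r : ℝ) * Complex.I)) =
      (conj (4 * (Real.pi : ℂ) * Complex.I * (r : ℂ)))⁻¹ := by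
    have : (Real.pi : ℂ) ≠ 0 := by exact_mod_cast Real.pi_ne_zero
    have : (r : ℂ) ≠ 0 := by exact_mod_cast hr
    simp [Complex.conj_ofNat]
    field_simp
    simp
  rw [e1, Complex.inv_cpow _ _ (hcz ▸ arg_ofReal_mul_I_ne_pi _),
    Complex.conj_cpow _ _ (hz ▸ arg_ofReal_mul_I_ne_pi _), neg_div, Complex.cpow_neg, map_inv₀]
  simp [Complex.conj_ofNat]

lemma integrable_conj_fourier_mul_fourier {n : ℕ} {f h : Rn n → ℂ} (hf₁ : Integrable f)
    (hf₂ : MemLp f 2) (hh₁ : Integrable h) (hh₂ : MemLp h 2) :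
    Integrable (fun ξ => conj (𝓕 f ξ) * 𝓕 h ξ) := by
  have hF : MemLp (𝓕 f) 2 := (memLp_congr_ae (coeFn_fourier_toLp hf₁ hf₂)).1 (Lp.memLp _)
  have hH : MemLp (𝓕 h) 2 := (memLp_congr_ae (coeFn_fourier_toLp hh₁ hh₂)).1 (Lp.memLp _)
  exact MemLp.integrable_mul (p := 2) (q := 2) hF.star hH

/-- The Schrödinger multiplier acts on `L¹ ∩ L²` through the explicit kernel. -/
lemma integral_multiplier_mul_conj_fourier_mul_fourier {n : ℕ} {r : ℝ} (hr : r ≠ 0)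
    {f h : Rn n → ℂ} (hf₁ : Integrable f) (hf₂ : MemLp f 2) (hh₁ : Integrable h)
    (hh₂ : MemLp h 2) :
    ∫ ξ : Rn n, Complex.exp ((4 * Real.pi ^ 2 * r * ‖ξ‖ ^ 2 : ℝ) * Complex.I) *
        (conj (𝓕 f ξ) * 𝓕 h ξ) = ∫ x, conj (schrodinger n r f x) * h x := by
  set d : ℝ := 4 * Real.pi ^ 2 * r with hd
  have hd0 : d ≠ 0 := by positivity
  set b : ℕ → ℂ := fun k => ((1 / ((k : ℝ) + 1) : ℝ) : ℂ) + -d * Complex.I with hb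
  have hbre : ∀ k, (b k).re = 1 / ((k : ℝ) + 1) := fun k => by
    simp only [hb, Complex.add_re, Complex.ofReal_re]
    simp
  have hbpos : ∀ k, 0 < (b k).re := fun k => by rw [hbre]; positivity
  set b' : ℂ := -d * Complex.I with hb'
  have hb'0 : b' ≠ 0 := by simp [hb', hd0]
  have hblim : Tendsto b atTop (𝓝 b') := by
    have := (Complex.continuous_ofReal.tendsto 0).comp tendsto_one_div_add_atTop_nhds_zero_nat
    simpa [hb, hb'] using this.add_const b'
  have hcf : Integrable (fun x => conj (f x)) := by
    simpa using (Complex.conjLIE.toContinuousLinearEquiv.integrable_comp_iff).2 hf₁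
  have hL : Tendsto (fun k => ∫ ξ : Rn n, Complex.exp (-b k * (‖ξ‖ : ℂ) ^ 2) *
      (conj (𝓕 f ξ) * 𝓕 h ξ)) atTop
      (𝓝 (∫ ξ : Rn n, Complex.exp (-b' * (‖ξ‖ : ℂ) ^ 2) * (conj (𝓕 f ξ) * 𝓕 h ξ))) := by
    have hint := integrable_conj_fourier_mul_fourier hf₁ hf₂ hh₁ hh₂
    refine tendsto_integral_of_dominated_convergence (fun ξ => ‖conj (𝓕 f ξ) * 𝓕 h ξ‖)
      (fun k => ?_) hint.norm (fun k => .of_forall fun ξ => ?_) (.of_forall fun ξ => ?_)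
    · exact (by fun_prop : Continuous fun ξ : Rn n =>
        Complex.exp (-b k * (‖ξ‖ : ℂ) ^ 2)).aestronglyMeasurable.mul hint.1
    · rw [norm_mul]
      refine mul_le_of_le_one_left (norm_nonneg _) ?_
      rw [Complex.norm_exp, Real.exp_le_one_iff]
      have : -b k * (‖ξ‖ : ℂ) ^ 2 = ((‖ξ‖ ^ 2 : ℝ) : ℂ) * (-b k) := by push_cast; ring
      rw [this, Complex.re_ofReal_mul, Complex.neg_re]
      have := mul_nonneg (sq_nonneg ‖ξ‖) (hbpos k).le
      linarith
    · refine Tendsto.mul_const _ ?_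
      exact (Complex.continuous_exp.tendsto _).comp (hblim.neg.mul_const _)
  have hR : Tendsto (fun k => ∫ x, (∫ y, Complex.exp (-Real.pi ^ 2 * (‖x - y‖ : ℂ) ^ 2 / b k) *
      conj (f y)) * h x) atTop
      (𝓝 (∫ x, (∫ y, Complex.exp (-Real.pi ^ 2 * (‖x - y‖ : ℂ) ^ 2 / b') * conj (f y)) * h x)) := by
    have hmeas : ∀ k, AEStronglyMeasurable
        (fun x => ∫ y, Complex.exp (-Real.pi ^ 2 * (‖x - y‖ : ℂ) ^ 2 / b k) * conj (f y)) := by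
      intro k
      refine AEStronglyMeasurable.integral_prod_right' (f := fun q : Rn n × Rn n =>
        Complex.exp (-Real.pi ^ 2 * (‖q.1 - q.2‖ : ℂ) ^ 2 / b k) * conj (f q.2)) ?_
      exact (by fun_prop : Continuous fun q : Rn n × Rn n =>
        Complex.exp (-Real.pi ^ 2 * (‖q.1 - q.2‖ : ℂ) ^ 2 / b k)).aestronglyMeasurable.mul
          hcf.1.comp_snd
    refine tendsto_integral_of_dominated_convergence (fun x => (∫ y, ‖conj (f y)‖) * ‖h x‖)
      (fun k => (hmeas k).mul hh₁.1) (hh₁.norm.const_mul _) (fun k => .of_forall fun x => ?_)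
      (.of_forall fun x => ?_)
    · rw [norm_mul]
      gcongr
      refine norm_integral_le_of_norm_le hcf.norm (.of_forall fun y => ?_)
      rw [norm_mul]
      exact mul_le_of_le_one_left (norm_nonneg _) (norm_cexp_neg_div_le_one (hbpos k).le _)
    · refine Tendsto.mul_const _ ?_
      refine tendsto_integral_of_dominated_convergence (fun y => ‖conj (f y)‖)
        (fun k => ?_) hcf.norm (fun k => .of_forall fun y => ?_) (.of_forall fun y => ?_)
      · exact (by fun_prop : Continuous fun y : Rn n =>
          Complex.exp (-Real.pi ^ 2 * (‖x - y‖ : ℂ) ^ 2 / b k)).aestronglyMeasurable.mul hcf.1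
      · rw [norm_mul]
        exact mul_le_of_le_one_left (norm_nonneg _) (norm_cexp_neg_div_le_one (hbpos k).le _)
      · refine Tendsto.mul_const _ ?_
        exact (Complex.continuous_exp.tendsto _).comp (tendsto_const_nhds.div hblim hb'0)
  have hc : Tendsto (fun k => ((Real.pi : ℂ) / b k) ^ (n / 2 : ℂ)) atTop
      (𝓝 (((Real.pi : ℂ) / b') ^ (n / 2 : ℂ))) := by
    refine (tendsto_const_nhds.div hblim hb'0).cpow tendsto_const_nhds ?_
    right
    have : ((Real.pi : ℂ) / b') = ((Real.pi / d : ℝ) : ℂ) * Complex.I := by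
      have : (d : ℂ) ≠ 0 := by exact_mod_cast hd0
      rw [hb']; push_cast; field_simp; simp
    rw [this]
    simp [hd0, Real.pi_ne_zero]
  have hkey : ∀ k, ∫ ξ : Rn n, Complex.exp (-b k * (‖ξ‖ : ℂ) ^ 2) * (conj (𝓕 f ξ) * 𝓕 h ξ) =
      ((Real.pi : ℂ) / b k) ^ (n / 2 : ℂ) * ∫ x, (∫ y,
        Complex.exp (-Real.pi ^ 2 * (‖x - y‖ : ℂ) ^ 2 / b k) * conj (f y)) * h x := by
    intro k
    rw [integral_gaussian_mul_conj_fourier_mul_fourier (hbpos k) hf₁ hh₁, ← integral_const_mul]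
    congr 1; ext x
    rw [← mul_assoc, ← integral_const_mul]
    simp_rw [mul_assoc]
  simp_rw [hkey] at hL
  have huniq := tendsto_nhds_unique hL (hc.mul hR)
  convert huniq using 1
  · congr 1; ext ξ
    congr 2
    rw [hb']; push_cast; ring
  · rw [← integral_const_mul]
    congr 1; ext x
    rw [← mul_assoc, schrodinger, map_mul, ← conj_schrodinger_const n hr, ← integral_conj]
    congr 2
    · simp [hb', hd]
      congr 1; ext y
      rw [← Complex.exp_conj]
      congr 2
      have : (Real.pi : ℂ) ≠ 0 := by exact_mod_cast Real.pi_ne_zero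
      have : (r : ℂ) ≠ 0 := by exact_mod_cast hr
      simp [Complex.conj_ofNat]
      field_simp
      simp

/-- A weakly measurable `TT*` inequality in a Hilbert space. -/
lemma enorm_integral_inner_sq_le {α H : Type*} [MeasurableSpace α] {μ : Measure α}
    [NormedAddCommGroup H] [InnerProductSpace ℂ H] [CompleteSpace H] {G : α → H}
    (hG : ∀ f, AEMeasurable (fun a => inner ℂ (G a) f) μ) {B : α → ℝ} (hB : Integrable B μ)
    (hGB : ∀ a, ‖G a‖ ≤ B a) (f : H) :
    ‖∫ a, inner ℂ (G a) f ∂μ‖ₑ ^ 2 ≤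
      ‖f‖ₑ ^ 2 * ∫⁻ a, ∫⁻ b, ‖inner ℂ (G b) (G a)‖ₑ ∂μ ∂μ := by
  have hbd : ∀ f a, ‖inner ℂ (G a) f‖ ≤ B a * ‖f‖ := fun f a =>
    (norm_inner_le_norm _ _).trans (by gcongr; exact hGB a)
  have hint : ∀ f, Integrable (fun a => inner ℂ (G a) f) μ := fun f =>
    (hB.mul_const ‖f‖).mono' (hG f).aestronglyMeasurable (.of_forall (hbd f))
  let l : H →L[ℂ] ℂ := LinearMap.mkContinuous
    { toFun := fun f => ∫ a, inner ℂ (G a) f ∂μ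
      map_add' := fun f g => by
        simp_rw [inner_add_right]; exact integral_add (hint f) (hint g)
      map_smul' := fun c f => by
        simp_rw [inner_smul_right]; exact integral_const_mul c _ } (∫ a, B a ∂μ)
    (fun f => by
      have := norm_integral_le_of_norm_le (hB.mul_const ‖f‖) (.of_forall (hbd f))
      rwa [integral_mul_const] at this)
  have hl : ∀ f, l f = ∫ a, inner ℂ (G a) f ∂μ := fun f => rfl
  set Φ := (InnerProductSpace.toDual ℂ H).symm l
  have hΦ : ∀ f, inner ℂ Φ f = ∫ a, inner ℂ (G a) f ∂μ := fun f => by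
    rw [← hl]; exact InnerProductSpace.toDual_symm_apply
  have h1 : ‖∫ a, inner ℂ (G a) f ∂μ‖ₑ ≤ ‖Φ‖ₑ * ‖f‖ₑ := by
    rw [← hΦ, ← ofReal_norm, ← ofReal_norm, ← ofReal_norm, ← ENNReal.ofReal_mul (norm_nonneg _)]
    exact ENNReal.ofReal_le_ofReal (norm_inner_le_norm _ _)
  have h2 : ‖Φ‖ₑ ^ 2 ≤ ∫⁻ a, ∫⁻ b, ‖inner ℂ (G b) (G a)‖ₑ ∂μ ∂μ := by
    have e : ‖Φ‖ₑ ^ 2 = ‖inner ℂ Φ Φ‖ₑ := by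
      rw [← ofReal_norm, ← ofReal_norm, inner_self_eq_norm_sq_to_K,
        ← ENNReal.ofReal_pow (norm_nonneg _)]
      simp
    rw [e, hΦ]
    refine (enorm_integral_le_lintegral_enorm _).trans (lintegral_mono fun a => ?_)
    have : ‖inner ℂ (G a) Φ‖ₑ = ‖inner ℂ Φ (G a)‖ₑ := by
      rw [← ofReal_norm, ← ofReal_norm, norm_inner_symm]
    rw [this, hΦ]
    exact enorm_integral_le_lintegral_enorm _
  calc _ ≤ (‖Φ‖ₑ * ‖f‖ₑ) ^ 2 := by gcongr
    _ = ‖f‖ₑ ^ 2 * ‖Φ‖ₑ ^ 2 := by ring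
    _ ≤ _ := by gcongr

/-- The Fourier multiplier of `e^{itΔ}`. -/
noncomputable def freeMultiplier (n : ℕ) (t : ℝ) (ξ : Rn n) : ℂ :=
  Complex.exp ((-(4 * Real.pi ^ 2 * t * ‖ξ‖ ^ 2) : ℝ) * Complex.I)

lemma norm_freeMultiplier (n : ℕ) (t : ℝ) (ξ : Rn n) : ‖freeMultiplier n t ξ‖ = 1 :=
  Complex.norm_exp_ofReal_mul_I _

lemma continuous_freeMultiplier (n : ℕ) :
    Continuous fun q : ℝ × Rn n => freeMultiplier n q.1 q.2 := by
  unfold freeMultiplier; fun_prop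

lemma memLp_freeMultiplier_mul_fourier {n : ℕ} (t : ℝ) (f : L2 n) :
    MemLp (fun ξ => freeMultiplier n t ξ * (𝓕 f : L2 n) ξ) 2 := by
  refine (Lp.memLp (𝓕 f : L2 n)).of_le (AEStronglyMeasurable.mul ?_ (Lp.aestronglyMeasurable _))
    (.of_forall fun ξ => by rw [norm_mul, norm_freeMultiplier, one_mul])
  exact ((continuous_freeMultiplier n).comp (by fun_prop :
    Continuous fun ξ : Rn n => (t, ξ))).aestronglyMeasurable

/-- The Fourier transform of `e^{itΔ} f`, as an element of `L²`. -/
noncomputable def freeEvolution {n : ℕ} (t : ℝ) (f : L2 n) : L2 n :=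
  (memLp_freeMultiplier_mul_fourier t f).toLp

lemma coeFn_freeEvolution {n : ℕ} (t : ℝ) (f : L2 n) :
    freeEvolution t f =ᵐ[volume] fun ξ => freeMultiplier n t ξ * (𝓕 f : L2 n) ξ :=
  MemLp.coeFn_toLp _

lemma norm_freeEvolution {n : ℕ} (t : ℝ) (f : L2 n) : ‖freeEvolution t f‖ = ‖f‖ := by
  rw [← Lp.norm_fourier_eq f]
  refine le_antisymm (Lp.norm_le_norm_of_ae_le ?_) (Lp.norm_le_norm_of_ae_le ?_) <;>
  · filter_upwards [coeFn_freeEvolution t f] with ξ hξ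
    rw [hξ, norm_mul, norm_freeMultiplier, one_mul]

lemma inner_freeEvolution {n : ℕ} {s t : ℝ} (hst : s ≠ t) {f h : Rn n → ℂ} (hf₁ : Integrable f)
    (hf₂ : MemLp f 2) (hh₁ : Integrable h) (hh₂ : MemLp h 2) :
    inner ℂ (freeEvolution t (hf₂.toLp f)) (freeEvolution s (hh₂.toLp h)) =
      ∫ x, conj (schrodinger n (t - s) f x) * h x := by
  rw [← integral_multiplier_mul_conj_fourier_mul_fourier (sub_ne_zero.2 hst.symm) hf₁ hf₂ hh₁ hh₂,
    L2.inner_def]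
  apply integral_congr_ae
  filter_upwards [coeFn_freeEvolution t (hf₂.toLp f), coeFn_freeEvolution s (hh₂.toLp h),
    coeFn_fourier_toLp hf₁ hf₂, coeFn_fourier_toLp hh₁ hh₂] with ξ e1 e2 e3 e4
  rw [e1, e2, e3, e4, RCLike.inner_apply, map_mul]
  have : Complex.exp ((4 * Real.pi ^ 2 * (t - s) * ‖ξ‖ ^ 2 : ℝ) * Complex.I) =
      conj (freeMultiplier n t ξ) * freeMultiplier n s ξ := by
    unfold freeMultiplier
    rw [← Complex.exp_conj, ← Complex.exp_add]
    congr 1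
    simp [Complex.conj_ofNat]
    ring
  rw [this]
  ring

lemma measurable_inner_freeEvolution {n : ℕ} {h : ℝ → Rn n → ℂ}
    (hm : Measurable fun q : ℝ × Rn n => h q.1 q.2) (h₁ : ∀ t, Integrable (h t))
    (h₂ : ∀ t, MemLp (h t) 2) (f : L2 n) :
    Measurable fun t => inner ℂ (freeEvolution (-t) ((h₂ t).toLp (h t))) f := by
  have e : ∀ t, inner ℂ (freeEvolution (-t) ((h₂ t).toLp (h t))) f =
      ∫ ξ, f ξ * conj (freeMultiplier n (-t) ξ * 𝓕 (h t) ξ) := by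
    intro t
    rw [L2.inner_def]
    apply integral_congr_ae
    filter_upwards [coeFn_freeEvolution (-t) ((h₂ t).toLp (h t)), coeFn_fourier_toLp (h₁ t) (h₂ t)]
      with ξ e1 e2
    rw [e1, e2, RCLike.inner_apply]
  simp_rw [e]
  have hF : StronglyMeasurable fun q : ℝ × Rn n => 𝓕 (h q.1) q.2 := by
    simp_rw [Real.fourier_eq']
    refine StronglyMeasurable.integral_prod_right' (f := fun q : (ℝ × Rn n) × Rn n =>
      Complex.exp (((-2 * Real.pi * ⟪q.2, q.1.2⟫ : ℝ) : ℂ) * Complex.I) • h q.1.1 q.2) ?_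
    refine Measurable.stronglyMeasurable (Measurable.fun_smul ?_ ?_)
    · exact (by fun_prop : Continuous fun q : (ℝ × Rn n) × Rn n =>
        Complex.exp (((-2 * Real.pi * ⟪q.2, q.1.2⟫ : ℝ) : ℂ) * Complex.I)).measurable
    · exact hm.comp (by fun_prop : Measurable fun q : (ℝ × Rn n) × Rn n => (q.1.1, q.2))
  refine StronglyMeasurable.measurable (StronglyMeasurable.integral_prod_right'
    (f := fun q : ℝ × Rn n => f q.2 * conj (freeMultiplier n (-q.1) q.2 * 𝓕 (h q.1) q.2)) ?_)
  refine ((Lp.stronglyMeasurable f).comp_measurable measurable_snd).mul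
    (Complex.continuous_conj.comp_stronglyMeasurable (StronglyMeasurable.mul ?_ hF))
  exact ((continuous_freeMultiplier n).comp (by fun_prop :
    Continuous fun q : ℝ × Rn n => (-q.1, q.2))).stronglyMeasurable

lemma ofReal_two_zpow (j : ℤ) : ENNReal.ofReal ((2 : ℝ) ^ j) = 2 ^ j := by
  rw [← Real.rpow_intCast, ← ENNReal.ofReal_rpow_of_pos two_pos, ENNReal.rpow_intCast,
    ENNReal.ofReal_ofNat]

/-- The largest dyadic height `2 ^ k` at which the superlevel set of `g` has measure more than
`2 ^ j`; comparable to the decreasing rearrangement of `g` at `2 ^ j`. -/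
noncomputable def dyadicRearrangement {α : Type*} [MeasurableSpace α] (μ : Measure α)
    (g : α → ℝ≥0∞) (j : ℤ) : ℝ≥0∞ :=
  ⨆ k : ℤ, if (2 : ℝ≥0∞) ^ j < μ {x | (2 : ℝ≥0∞) ^ k < g x} then 2 ^ k else 0

lemma rearrangement_anti {α E : Type*} [MeasurableSpace α] (μ : Measure α) [NNNorm E] (f : α → E) :
    Antitone (rearrangement μ f) := fun _ _ hst =>
  sInf_le_sInf fun _ hl => le_trans (mem_ofPred.1 hl) (ENNReal.ofReal_le_ofReal hst)

lemma rearrangement_zpow_le {α E : Type*} [MeasurableSpace α] (μ : Measure α) [NNNorm E]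
    {f : α → E} {g : α → ℝ≥0∞} (hfg : ∀ x, (‖f x‖₊ : ℝ≥0∞) ≤ g x) (j : ℤ) :
    rearrangement μ f (2 ^ j) ≤ 2 * dyadicRearrangement μ g j := by
  refine le_of_forall_gt fun l hl => ?_
  obtain ⟨m, hm, hml⟩ := exists_between hl
  refine lt_of_le_of_lt (sInf_le ?_) hml
  rw [mem_ofPred_eq]
  by_contra! hD
  obtain ⟨k, hk₁, hk₂⟩ := ENNReal.exists_mem_Ico_zpow (x := m) (y := 2)
    (ne_bot_of_gt hm) (ne_top_of_lt hml) (by norm_num) (by norm_num)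
  have h1 : (2 : ℝ≥0∞) ^ j < μ {x | (2 : ℝ≥0∞) ^ k < g x} := by
    rw [ofReal_two_zpow] at hD
    refine lt_of_lt_of_le (by simpa using hD) (measure_mono fun x hx => ?_)
    exact (hk₁.trans_lt hx).trans_le (hfg x)
  have h2 : (2 : ℝ≥0∞) ^ k ≤ dyadicRearrangement μ g j := by
    refine le_trans ?_ (le_iSup _ k)
    rw [if_pos h1]
  rw [ENNReal.zpow_add (by norm_num) (by norm_num), zpow_one, mul_comm] at hk₂
  exact absurd (hk₂.trans_le (mul_le_mul_right h2 2)) hm.le.not_gt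

lemma lornorm_sq_le {n : ℕ} {p : ℝ} (hp : 2 ≤ p) {f : Rn n → ℂ} {g : Rn n → ℝ≥0∞}
    (hfg : ∀ x, ‖f x‖ₑ ≤ g x) :
    lornorm n p f ^ 2 ≤
      8 * ∑' j : ℤ, ((2 : ℝ≥0∞) ^ (j / p : ℝ) * dyadicRearrangement volume g j) ^ 2 := by
  have hp0 : 0 < p := by linarith
  have hsq : lornorm n p f ^ 2 = ∫⁻ t in Ioi (0:ℝ),
      (ENNReal.ofReal (t ^ p⁻¹) * rearrangement volume f t) ^ 2 * ENNReal.ofReal t⁻¹ := by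
    rw [lornorm, lorentzNorm, if_neg (by norm_num), ENNReal.toReal_ofReal hp0.le,
      ← ENNReal.rpow_natCast, ← ENNReal.rpow_mul]
    simp
  have hsub : Ioi (0 : ℝ) ⊆ ⋃ j : ℤ, Ico ((2 : ℝ) ^ j) (2 ^ (j + 1)) := fun t ht => by
    obtain ⟨j, hj⟩ := exists_mem_Ico_zpow (x := t) (y := 2) ht (by norm_num)
    exact mem_iUnion.2 ⟨j, hj⟩
  rw [hsq, ← ENNReal.tsum_mul_left]
  refine (lintegral_mono_set hsub).trans ((lintegral_iUnion_le _ _).trans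
    (ENNReal.tsum_le_tsum fun j => ?_))
  have hpw : (0 : ℝ) < 2 ^ j := by positivity
  calc _ ≤ ∫⁻ t in Ico ((2 : ℝ) ^ j) (2 ^ (j + 1)), ((2 * ((2 : ℝ≥0∞) ^ (j / p : ℝ)) ^ 2) *
        (2 * dyadicRearrangement volume g j) ^ 2) * ((2 : ℝ≥0∞) ^ j)⁻¹ := by
        refine setLIntegral_mono' measurableSet_Ico fun t ht => ?_
        have ht0 : 0 < t := hpw.trans_le ht.1
        rw [mul_pow]
        gcongr
        · rw [← ENNReal.ofReal_pow (by positivity), ← ENNReal.rpow_mul_natCast]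
          have : (2 : ℝ≥0∞) * 2 ^ (j / p * (2 : ℕ) : ℝ) =
              ENNReal.ofReal (2 * 2 ^ (j / p * 2 : ℝ)) := by
            rw [ENNReal.ofReal_mul (by norm_num), ← ENNReal.ofReal_rpow_of_pos (by norm_num)]
            simp
          rw [this]
          apply ENNReal.ofReal_le_ofReal
          rw [← Real.rpow_natCast, ← Real.rpow_mul ht0.le]
          calc t ^ (p⁻¹ * (2 : ℕ)) ≤ ((2 : ℝ) ^ ((j : ℝ) + 1)) ^ (p⁻¹ * (2 : ℕ)) := by
                have := ht.2.le
                gcongr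
                exact_mod_cast this
            _ = 2 ^ (2 / p) * 2 ^ (j / p * 2 : ℝ) := by
                rw [← Real.rpow_mul (by norm_num), ← Real.rpow_add (by norm_num)]
                congr 1; push_cast; ring
            _ ≤ 2 * 2 ^ (j / p * 2 : ℝ) := by
                gcongr
                calc (2 : ℝ) ^ (2 / p) ≤ 2 ^ (1 : ℝ) := by
                      apply Real.rpow_le_rpow_of_exponent_le (by norm_num)
                      rwa [div_le_one hp0]
                  _ = 2 := by simp
        · refine (rearrangement_anti _ _ ht.1).trans (rearrangement_zpow_le _ hfg j)
        · rw [ENNReal.ofReal_inv_of_pos ht0]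
          gcongr
          have := ENNReal.ofReal_le_ofReal ht.1
          rw [ofReal_two_zpow] at this
          simpa using this
    _ = _ := by
        rw [lintegral_const, Measure.restrict_apply_univ, Real.volume_Ico, zpow_add₀ two_ne_zero]
        have h2 : (2 : ℝ) ^ j * 2 ^ (1 : ℤ) - 2 ^ j = 2 ^ j := by simp; ring
        rw [h2, ofReal_two_zpow, mul_assoc, ENNReal.inv_mul_cancel
          (ENNReal.zpow_pos two_ne_zero ofNat_ne_top _).ne'
          (ENNReal.zpow_ne_top two_ne_zero ofNat_ne_top _)]
        ring

lemma exists_tsum_min_rpow_le {a b : ℝ} (ha : 0 < a) (hb : 0 < b) :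
    ∃ C : ℝ≥0∞, C ≠ ∞ ∧ ∀ c : ℝ≥0∞, c ≠ 0 → c ≠ ∞ →
      ∑' m : ℤ, min (((2 : ℝ≥0∞) ^ m * c) ^ (-a)) (((2 : ℝ≥0∞) ^ m * c) ^ b) ≤ C := by
  have hgeo : ∀ d : ℝ, 0 < d → ∑' k : ℕ, ((2 : ℝ≥0∞) ^ (-d)) ^ k ≠ ∞ := fun d hd => by
    rw [ENNReal.tsum_geometric, ENNReal.inv_ne_top]
    refine (tsub_pos_of_lt ?_).ne'
    exact ENNReal.rpow_lt_one_of_one_lt_of_neg (by norm_num) (by linarith)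
  refine ⟨_, ENNReal.add_ne_top.2 ⟨hgeo a ha, hgeo b hb⟩, fun c hc0 hc => ?_⟩
  obtain ⟨i, hi₁, hi₂⟩ := ENNReal.exists_mem_Ico_zpow hc0 hc (y := 2) (by norm_num) (by norm_num)
  rw [← (Equiv.subRight i).tsum_eq]
  simp only [Equiv.subRight_apply]
  have hz : ∀ k : ℤ, (2 : ℝ≥0∞) ^ k = 2 ^ (k : ℝ) := fun k => (ENNReal.rpow_intCast _ _).symm
  have key : ∀ m : ℤ, (2 : ℝ≥0∞) ^ (m : ℝ) ≤ 2 ^ (m - i) * c ∧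
      2 ^ (m - i) * c ≤ (2 : ℝ≥0∞) ^ ((m : ℝ) + 1) := fun m => by
    constructor
    · calc (2 : ℝ≥0∞) ^ (m : ℝ) = 2 ^ (m - i) * 2 ^ i := by
            rw [← ENNReal.zpow_add (by norm_num) (by norm_num), hz]; congr 2; ring
        _ ≤ _ := by gcongr
    · calc 2 ^ (m - i) * c ≤ (2 : ℝ≥0∞) ^ (m - i) * 2 ^ (i + 1) := by gcongr
        _ = _ := by
            rw [← ENNReal.zpow_add (by norm_num) (by norm_num), hz]; congr 1; push_cast; ring
  rw [tsum_of_nat_of_neg_add_one ENNReal.summable ENNReal.summable]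
  refine add_le_add (ENNReal.tsum_le_tsum fun k => ?_) (ENNReal.tsum_le_tsum fun k => ?_)
  · refine (min_le_left _ _).trans ?_
    rw [ENNReal.rpow_neg, ENNReal.rpow_neg, ← ENNReal.inv_pow, ENNReal.inv_le_inv,
      ← ENNReal.rpow_natCast, ← ENNReal.rpow_mul, mul_comm a, ENNReal.rpow_mul]
    exact ENNReal.rpow_le_rpow (key k).1 ha.le
  · refine (min_le_right _ _).trans ?_
    rw [← ENNReal.rpow_natCast, ← ENNReal.rpow_mul]
    calc _ ≤ ((2 : ℝ≥0∞) ^ (((-((k : ℤ) + 1) : ℤ) : ℝ) + 1)) ^ b :=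
          ENNReal.rpow_le_rpow (key _).2 hb.le
      _ = _ := by
          rw [← ENNReal.rpow_mul]; congr 1; push_cast; ring

lemma tsum_mul_le_sqrt_mul_sqrt {ι : Type*} (v w : ι → ℝ≥0∞) :
    ∑' j, v j * w j ≤ (∑' j, v j ^ 2) ^ (1 / 2 : ℝ) * (∑' j, w j ^ 2) ^ (1 / 2 : ℝ) := by
  let _ : MeasurableSpace ι := ⊤
  have := ENNReal.lintegral_mul_le_Lp_mul_Lq (μ := Measure.count) Real.HolderConjugate.two_two
    (f := v) (g := w) (Measurable.aemeasurable fun _ _ => trivial)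
    (Measurable.aemeasurable fun _ _ => trivial)
  simpa [lintegral_count] using this

/-- Young's inequality on `ℤ` for a kernel depending on `j + l`. -/
lemma tsum_tsum_mul_le (v w K : ℤ → ℝ≥0∞) :
    ∑' j, ∑' l, v j * w l * K (j + l) ≤
      (∑' m, K m) * ((∑' j, v j ^ 2) ^ (1 / 2 : ℝ) * (∑' j, w j ^ 2) ^ (1 / 2 : ℝ)) := by
  have e : ∀ j, ∑' l, v j * w l * K (j + l) = ∑' m, K m * (v j * w (m - j)) := fun j => by
    rw [← (Equiv.addLeft j).tsum_eq (fun m => K m * (v j * w (m - j)))]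
    simp [mul_comm]
  simp_rw [e]
  rw [ENNReal.tsum_comm, ← ENNReal.tsum_mul_right]
  refine ENNReal.tsum_le_tsum fun m => ?_
  rw [ENNReal.tsum_mul_left]
  gcongr
  refine (tsum_mul_le_sqrt_mul_sqrt v fun j => w (m - j)).trans_eq ?_
  rw [← (Equiv.subLeft m).tsum_eq fun j => w j ^ 2]
  rfl

lemma lintegral_comp_abs (f : ℝ → ℝ≥0∞) : ∫⁻ u, f |u| = 2 * ∫⁻ u in Ioi 0, f u := by
  have h1 : ∫⁻ u in Ioi (0 : ℝ), f |u| = ∫⁻ u in Ioi 0, f u :=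
    setLIntegral_congr_fun measurableSet_Ioi fun u hu => by
      simp only [abs_of_pos (mem_Ioi.1 hu)]
  have h2 : ∫⁻ u in Iio (0 : ℝ), f |u| = ∫⁻ u in Ioi 0, f |u| := by
    rw [← lintegral_indicator measurableSet_Iio, ← lintegral_indicator measurableSet_Ioi,
      ← lintegral_neg_eq_self]
    congr 1
    ext u
    simp [indicator]
  rw [← lintegral_add_compl _ measurableSet_Ioi (A := Ioi (0 : ℝ)), compl_Ioi,
    ← setLIntegral_congr Iio_ae_eq_Iic, h2, h1, two_mul]

lemma lintegral_indicator_Iic_rpow {a R : ℝ} (ha : a < 1) (hR : 0 ≤ R) :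
    ∫⁻ u : ℝ, (Iic R).indicator (fun v => ENNReal.ofReal (v ^ (-a))) |u| =
      ENNReal.ofReal (2 / (1 - a)) * ENNReal.ofReal R ^ (1 - a) := by
  rw [lintegral_comp_abs (f := (Iic R).indicator (fun v => ENNReal.ofReal (v ^ (-a)))),
    setLIntegral_indicator measurableSet_Iic, inter_comm, Ioi_inter_Iic,
    ← ofReal_integral_eq_lintegral_ofReal, ← intervalIntegral.integral_of_le hR,
    integral_rpow (Or.inl (by linarith)), Real.zero_rpow (by linarith),
    ENNReal.ofReal_rpow_of_nonneg hR (by linarith), ← ENNReal.ofReal_mul (by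
      have : 0 < 1 - a := by linarith
      positivity)]
  · rw [show (2 : ℝ≥0∞) = ENNReal.ofReal 2 by simp, ← ENNReal.ofReal_mul (by norm_num)]
    congr 1
    rw [sub_zero, neg_add_eq_sub]
    ring
  · exact (intervalIntegral.intervalIntegrable_rpow' (by linarith)).1
  · filter_upwards [ae_restrict_mem measurableSet_Ioc] with u hu
    exact Real.rpow_nonneg hu.1.le _

lemma lintegral_indicator_Ioi_rpow {R : ℝ} (hR : 0 < R) :
    ∫⁻ u : ℝ, (Ioi R).indicator (fun v => ENNReal.ofReal (v ^ (-2 : ℝ))) |u| =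
      2 * (ENNReal.ofReal R)⁻¹ := by
  rw [lintegral_comp_abs (f := (Ioi R).indicator (fun v => ENNReal.ofReal (v ^ (-2 : ℝ)))),
    setLIntegral_indicator measurableSet_Ioi, Ioi_inter_Ioi, max_eq_left hR.le,
    ← ofReal_integral_eq_lintegral_ofReal, integral_Ioi_rpow_of_lt (by norm_num) hR,
    ← ENNReal.ofReal_inv_of_pos hR]
  · congr 2
    norm_num [Real.rpow_neg_one]
  · exact integrableOn_Ioi_rpow_of_lt (by norm_num) hR
  · filter_upwards [ae_restrict_mem measurableSet_Ioi] with u hu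
    exact Real.rpow_nonneg (hR.trans hu).le _

/-- The part of the fractional integral where `H s` does not exceed a height `h`. -/
lemma lintegral_rpow_mul_riesz_le {α : ℝ} (hα : 0 < α) (hα' : α < 1 / 2) {H : ℝ → ℝ≥0∞}
    (hH : Measurable H) (hA : ∫⁻ s, H s ≠ 0) (hA' : ∫⁻ s, H s ≠ ∞) {h : ℝ≥0∞} (hh : h ≠ 0)
    (hh' : h ≠ ∞) (t : ℝ) :
    ∫⁻ s, min (H s) h ^ (1 - α) * ENNReal.ofReal (|t - s| ^ (-(2 * α))) ≤
      (ENNReal.ofReal (2 / (1 - 2 * α)) + 2) * (h ^ α * (∫⁻ s, H s) ^ (1 - 2 * α)) := by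
  set A := ∫⁻ s, H s
  set R : ℝ := (A / h).toReal
  have hAh : A / h ≠ ∞ := ENNReal.div_ne_top hA' hh
  have hAh0 : A / h ≠ 0 := ENNReal.div_ne_zero.2 ⟨hA, hh'⟩
  have hR : 0 < R := ENNReal.toReal_pos hAh0 hAh
  have hRA : ENNReal.ofReal R = A / h := ENNReal.ofReal_toReal hAh
  set κ : ℝ → ℝ≥0∞ := fun v => ENNReal.ofReal (v ^ (-(2 * α)))
  have hκ : Measurable κ := by fun_prop
  have hpow : ∀ x y : ℝ, (A / h) ^ x * h ^ y = A ^ x * h ^ (y - x) := fun x y => by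
    rw [div_eq_mul_inv, ENNReal.mul_rpow_of_ne_top hA' (ENNReal.inv_ne_top.2 hh),
      ENNReal.inv_rpow, ← ENNReal.rpow_neg, mul_assoc, ← ENNReal.rpow_add _ _ hh hh', neg_add_eq_sub]
  have near : ∫⁻ s, h ^ (1 - α) * (Iic R).indicator κ |t - s| =
      ENNReal.ofReal (2 / (1 - 2 * α)) * (h ^ α * A ^ (1 - 2 * α)) := by
    rw [lintegral_const_mul' _ _ (ENNReal.rpow_ne_top_of_nonneg (by linarith) hh'),
      lintegral_sub_left_eq_self (fun u => (Iic R).indicator κ |u|) t,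
      lintegral_indicator_Iic_rpow (by linarith) hR.le, hRA, mul_left_comm, mul_comm (h ^ _),
      hpow, mul_comm (A ^ _)]
    congr 3
    ring
  have far : ∫⁻ s, H s ^ (1 - α) * (Ioi R).indicator κ |t - s| ≤
      2 * (h ^ α * A ^ (1 - 2 * α)) := by
    have e : ∀ s, (Ioi R).indicator κ |t - s| =
        (Ioi R).indicator (fun v => ENNReal.ofReal (v ^ (-2 : ℝ))) |t - s| ^ α := fun s => by
      by_cases hs : |t - s| ∈ Ioi R
      · rw [indicator_of_mem hs, indicator_of_mem hs, ENNReal.ofReal_rpow_of_nonneg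
          (by positivity) hα.le, ← Real.rpow_mul (abs_nonneg _)]
        simp [κ]
      · rw [indicator_of_notMem hs, indicator_of_notMem hs, ENNReal.zero_rpow_of_pos hα]
    simp_rw [e]
    refine (ENNReal.lintegral_mul_norm_pow_le hH.aemeasurable ?_ (by linarith) hα.le
      (by ring)).trans ?_
    · refine Measurable.aemeasurable (Measurable.comp (g := (Ioi R).indicator
        fun v => ENNReal.ofReal (v ^ (-2 : ℝ))) ?_ (by fun_prop : Measurable fun s => |t - s|))
      exact Measurable.indicator (by fun_prop) measurableSet_Ioi
    · rw [lintegral_sub_left_eq_self (fun u => (Ioi R).indicator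
        (fun v => ENNReal.ofReal (v ^ (-2 : ℝ))) |u|) t, lintegral_indicator_Ioi_rpow hR, hRA,
        ENNReal.mul_rpow_of_nonneg _ _ hα.le]
      have h2 : (2 : ℝ≥0∞) ^ α ≤ 2 := by
        simpa using ENNReal.rpow_le_rpow_of_exponent_le (x := 2) (by norm_num)
          (by linarith : α ≤ 1)
      calc A ^ (1 - α) * (2 ^ α * (A / h)⁻¹ ^ α) ≤ A ^ (1 - α) * (2 * (A / h)⁻¹ ^ α) := by gcongr
        _ = _ := by
          rw [ENNReal.inv_rpow, ← ENNReal.rpow_neg]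
          have := hpow (-α) 0
          rw [ENNReal.rpow_zero, mul_one] at this
          rw [this, mul_left_comm, ← mul_assoc (A ^ _), ← ENNReal.rpow_add _ _ hA hA',
            mul_comm (A ^ _)]
          congr 3 <;> ring
  calc _ ≤ ∫⁻ s, (h ^ (1 - α) * (Iic R).indicator κ |t - s| +
        H s ^ (1 - α) * (Ioi R).indicator κ |t - s|) := by
        refine lintegral_mono fun s => ?_
        rcases le_or_gt |t - s| R with hs | hs
        · refine le_add_right ?_
          rw [indicator_of_mem (mem_Iic.2 hs)]
          gcongr
          · linarith
          · exact min_le_right _ _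
        · refine le_add_left ?_
          rw [indicator_of_mem (mem_Ioi.2 hs)]
          gcongr
          · linarith
          · exact min_le_left _ _
    _ = (∫⁻ s, h ^ (1 - α) * (Iic R).indicator κ |t - s|) +
        ∫⁻ s, H s ^ (1 - α) * (Ioi R).indicator κ |t - s| := by
        refine lintegral_add_left (Measurable.const_mul ?_ _) _
        exact (hκ.indicator measurableSet_Iic).comp (by fun_prop : Measurable fun s => |t - s|)
    _ ≤ _ := by rw [near, add_mul]; gcongr

/-- A diagonal case of the Hardy-Littlewood-Sobolev inequality. -/
lemma exists_lintegral_riesz_le {α : ℝ} (hα : 0 < α) (hα' : α < 1 / 2) :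
    ∃ C : ℝ≥0∞, C ≠ ∞ ∧ ∀ H : ℝ → ℝ≥0∞, Measurable H → (∀ t, H t ≠ ∞) → ∫⁻ s, H s ≠ ∞ →
      ∫⁻ t, ∫⁻ s, H t ^ (1 - α) * H s ^ (1 - α) * ENNReal.ofReal (|t - s| ^ (-(2 * α))) ≤
        C * (∫⁻ s, H s) ^ (2 - 2 * α) := by
  refine ⟨2 * (ENNReal.ofReal (2 / (1 - 2 * α)) + 2), ENNReal.mul_ne_top (by norm_num)
    (ENNReal.add_ne_top.2 ⟨ofReal_ne_top, by norm_num⟩), fun H hH hHt hA' => ?_⟩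
  set C₀ := ENNReal.ofReal (2 / (1 - 2 * α)) + 2
  have h1α : 0 < 1 - α := by linarith
  rcases eq_or_ne (∫⁻ s, H s) 0 with hA | hA
  · have h0 : ∀ᵐ t, H t = 0 := (lintegral_eq_zero_iff hH).1 hA
    refine le_of_eq_of_le ?_ zero_le
    rw [lintegral_eq_zero_iff' ?_]
    · filter_upwards [h0] with t ht
      simp [ht, h1α]
    · fun_prop
  set F : ℝ → ℝ → ℝ≥0∞ := fun t s =>
    H t ^ (1 - α) * (min (H s) (H t) ^ (1 - α) * ENNReal.ofReal (|t - s| ^ (-(2 * α))))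
  have hF : Measurable fun q : ℝ × ℝ => F q.1 q.2 := by
    have h1 : Measurable fun q : ℝ × ℝ => H q.1 := hH.comp measurable_fst
    have h2 : Measurable fun q : ℝ × ℝ => H q.2 := hH.comp measurable_snd
    fun_prop
  have hpt : ∀ t, ∫⁻ s, F t s ≤ H t * (C₀ * (∫⁻ s, H s) ^ (1 - 2 * α)) := fun t => by
    rcases eq_or_ne (H t) 0 with ht | ht
    · simp [F, ht, h1α]
    rw [lintegral_const_mul' _ _ (ENNReal.rpow_ne_top_of_nonneg h1α.le (hHt t))]
    calc _ ≤ H t ^ (1 - α) * (C₀ * (H t ^ α * (∫⁻ s, H s) ^ (1 - 2 * α))) := by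
          gcongr
          exact lintegral_rpow_mul_riesz_le hα hα' hH hA hA' ht (hHt t) t
      _ = (H t ^ (1 - α) * H t ^ α) * (C₀ * (∫⁻ s, H s) ^ (1 - 2 * α)) := by ring
      _ = _ := by rw [← ENNReal.rpow_add _ _ ht (hHt t)]; simp
  calc _ ≤ ∫⁻ t, ∫⁻ s, (F t s + F s t) := by
        refine lintegral_mono fun t => lintegral_mono fun s => ?_
        rcases le_total (H s) (H t) with hst | hst
        · refine le_add_right ?_
          simp only [F, min_eq_left hst, mul_assoc, le_refl]
        · refine le_add_left (le_of_eq ?_)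
          simp only [F, min_eq_left hst, abs_sub_comm s t]
          ring
    _ = (∫⁻ t, ∫⁻ s, F t s) + ∫⁻ t, ∫⁻ s, F s t := by
        rw [← lintegral_add_left hF.lintegral_prod_right']
        congr 1; ext t
        exact lintegral_add_left (hF.comp (by fun_prop : Measurable fun s : ℝ => (t, s))) _
    _ = 2 * ∫⁻ t, ∫⁻ s, F t s := by
        rw [two_mul, lintegral_lintegral_swap (f := fun t s => F s t)]
        exact (hF.comp measurable_swap).aemeasurable
    _ ≤ 2 * ∫⁻ t, H t * (C₀ * (∫⁻ s, H s) ^ (1 - 2 * α)) := by gcongr with t; exact hpt t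
    _ = _ := by
        rw [lintegral_mul_const _ hH, show (2 - 2 * α) = 1 + (1 - 2 * α) by ring,
          ENNReal.rpow_add _ _ hA hA', ENNReal.rpow_one]
        ring

lemma exists_sum_sum_interpolated_kernel_le {p : ℝ} (hp : 2 < p) :
    ∃ C : ℝ≥0∞, C ≠ ∞ ∧ ∀ (S : Finset ℤ) (v w : ℤ → ℝ≥0∞) (D : ℝ≥0∞), D ≠ 0 → D ≠ ∞ →
      ∑ j ∈ S, ∑ l ∈ S, v j * w l * ((2 : ℝ≥0∞) ^ (-((j + l : ℤ) * (1 - 1 / p)) : ℝ) *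
        min ((2 : ℝ≥0∞) ^ ((j + l : ℤ) / 2 : ℝ)) (D * 2 ^ ((j + l : ℤ) : ℝ))) ≤
      C * D ^ (1 - 2 / p) *
        ((∑ j ∈ S, v j ^ 2) ^ (1 / 2 : ℝ) * (∑ j ∈ S, w j ^ 2) ^ (1 / 2 : ℝ)) := by
  have hp0 : 0 < p := by linarith
  have ha : 0 < 1 / 2 - 1 / p := by
    have := one_div_lt_one_div_of_lt two_pos hp
    linarith
  obtain ⟨C, hC, hCb⟩ := exists_tsum_min_rpow_le ha (b := 1 / p) (by positivity)
  refine ⟨C, hC, fun S v w D hD0 hD => ?_⟩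
  set c := D ^ (2 : ℝ)
  have hc0 : c ≠ 0 := (ENNReal.rpow_pos hD0.bot_lt hD).ne'
  have hc : c ≠ ∞ := ENNReal.rpow_ne_top_of_nonneg (by norm_num) hD
  have hz : ∀ m : ℤ, ∀ x : ℝ, ((2 : ℝ≥0∞) ^ m * c) ^ x = 2 ^ (m * x : ℝ) * D ^ (2 * x) := by
    intro m x
    rw [← ENNReal.rpow_intCast, ENNReal.mul_rpow_of_ne_top
      (ENNReal.rpow_ne_top_of_ne_zero (by norm_num) (by norm_num)) hc, ← ENNReal.rpow_mul,
      ← ENNReal.rpow_mul]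
  have hK : ∀ m : ℤ, (2 : ℝ≥0∞) ^ (-(m * (1 - 1 / p)) : ℝ) *
      min ((2 : ℝ≥0∞) ^ (m / 2 : ℝ)) (D * 2 ^ (m : ℝ)) = D ^ (1 - 2 / p) *
        min (((2 : ℝ≥0∞) ^ m * c) ^ (-(1 / 2 - 1 / p))) ((2 ^ m * c) ^ (1 / p)) := by
    intro m
    have hmono : ∀ x : ℝ≥0∞, Monotone (x * ·) := fun x _ _ h => mul_le_mul_right h x
    rw [(hmono _).map_min, (hmono _).map_min, hz, hz, mul_left_comm (D ^ _),
      mul_left_comm (D ^ _), ← ENNReal.rpow_add _ _ hD0 hD, ← ENNReal.rpow_add _ _ hD0 hD,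
      mul_left_comm, ← ENNReal.rpow_add _ _ (by norm_num) (by norm_num),
      ← ENNReal.rpow_add _ _ (by norm_num) (by norm_num)]
    congr 1
    · rw [show 1 - 2 / p + 2 * -(1 / 2 - 1 / p) = 0 by ring, ENNReal.rpow_zero, mul_one]
      congr 1; ring
    · rw [show 1 - 2 / p + 2 * (1 / p) = 1 by ring, ENNReal.rpow_one, mul_comm]
      congr 2; ring
  simp_rw [hK]
  have hind : ∀ u : ℤ → ℝ≥0∞, ∑' j, (S : Set ℤ).indicator u j ^ 2 = ∑ j ∈ S, u j ^ 2 := fun u => by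
    rw [tsum_eq_sum (s := S) fun j hj => by simp [hj]]
    exact Finset.sum_congr rfl fun j hj => by simp [hj]
  set φ : ℤ → ℝ≥0∞ := fun m =>
    min (((2 : ℝ≥0∞) ^ m * c) ^ (-(1 / 2 - 1 / p))) ((2 ^ m * c) ^ (1 / p))
  calc _ = ∑ j ∈ S, ∑ l ∈ S, D ^ (1 - 2 / p) * ((S : Set ℤ).indicator v j *
        (S : Set ℤ).indicator w l * φ (j + l)) := by
        refine Finset.sum_congr rfl fun j hj => Finset.sum_congr rfl fun l hl => ?_
        rw [indicator_of_mem (by simpa), indicator_of_mem (by simpa)]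
        ring
    _ = D ^ (1 - 2 / p) * ∑ j ∈ S, ∑ l ∈ S, ((S : Set ℤ).indicator v j *
        (S : Set ℤ).indicator w l * φ (j + l)) := by simp_rw [Finset.mul_sum]
    _ ≤ D ^ (1 - 2 / p) * ∑' j, ∑' l, ((S : Set ℤ).indicator v j *
        (S : Set ℤ).indicator w l * φ (j + l)) := by
        gcongr
        refine (Finset.sum_le_sum fun j _ => ENNReal.sum_le_tsum S).trans (ENNReal.sum_le_tsum S)
    _ ≤ D ^ (1 - 2 / p) * (C * ((∑ j ∈ S, v j ^ 2) ^ (1 / 2 : ℝ) *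
        (∑ j ∈ S, w j ^ 2) ^ (1 / 2 : ℝ))) := by
        gcongr
        refine (tsum_tsum_mul_le _ _ φ).trans ?_
        rw [hind, hind]
        gcongr
        exact hCb c hc0 hc
    _ = _ := by ring

lemma norm_schrodinger_const_le (n : ℕ) {r : ℝ} (hr : r ≠ 0) :
    ‖(4 * (Real.pi : ℂ) * Complex.I * (r : ℂ)) ^ (-(n : ℂ) / 2)‖ ≤ |r| ^ (-(n / 2 : ℝ)) := by
  have hz : (4 * (Real.pi : ℂ) * Complex.I * (r : ℂ)) ≠ 0 := by
    simp [hr, Real.pi_ne_zero]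
  have e : (-(n : ℂ) / 2) = ((-(n / 2 : ℝ) : ℝ) : ℂ) := by push_cast; ring
  rw [e, Complex.norm_cpow_of_ne_zero hz]
  simp only [Complex.ofReal_re, Complex.ofReal_im, mul_zero, Real.exp_zero, div_one]
  apply Real.rpow_le_rpow_of_nonpos (abs_pos.2 hr)
  · simp only [norm_mul, Complex.norm_ofNat, Complex.norm_real, Complex.norm_I, mul_one,
      Real.norm_eq_abs, abs_of_pos Real.pi_pos]
    exact le_mul_of_one_le_left (abs_nonneg r) (by linarith [Real.pi_gt_three])
  · have : (0 : ℝ) ≤ n / 2 := by positivity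
    linarith

lemma enorm_schrodinger_le {n : ℕ} {r : ℝ} (hr : r ≠ 0) (f : Rn n → ℂ) (x : Rn n) :
    ‖schrodinger n r f x‖ₑ ≤ ENNReal.ofReal (|r| ^ (-(n / 2 : ℝ))) * eLpNorm f 1 volume := by
  rw [schrodinger, enorm_mul, eLpNorm_one_eq_lintegral_enorm, ← ofReal_norm]
  refine mul_le_mul' (ENNReal.ofReal_le_ofReal (norm_schrodinger_const_le n hr))
    ((enorm_integral_le_lintegral_enorm _).trans_eq (lintegral_congr fun y => ?_))
  have : Complex.I * ((‖x - y‖ : ℂ)) ^ 2 / (4 * (r : ℂ)) =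
      ((‖x - y‖ ^ 2 / (4 * r) : ℝ) : ℂ) * Complex.I := by push_cast; ring
  rw [enorm_mul, this, ← ofReal_norm, Complex.norm_exp_ofReal_mul_I]
  simp

lemma enorm_inner_freeEvolution_le {n : ℕ} {s t : ℝ} (hst : s ≠ t) {f h : Rn n → ℂ}
    (hf₁ : Integrable f) (hf₂ : MemLp f 2) (hh₁ : Integrable h) (hh₂ : MemLp h 2) :
    ‖inner ℂ (freeEvolution t (hf₂.toLp f)) (freeEvolution s (hh₂.toLp h))‖ₑ ≤
      min (eLpNorm f 2 volume * eLpNorm h 2 volume)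
        (ENNReal.ofReal (|t - s| ^ (-(n / 2 : ℝ))) *
          (eLpNorm f 1 volume * eLpNorm h 1 volume)) := by
  refine le_min ?_ ?_
  · rw [← Lp.enorm_toLp hf₂, ← Lp.enorm_toLp hh₂, ← ofReal_norm, ← ofReal_norm, ← ofReal_norm,
      ← norm_freeEvolution t (hf₂.toLp f), ← norm_freeEvolution s (hh₂.toLp h),
      ← ENNReal.ofReal_mul (norm_nonneg _)]
    exact ENNReal.ofReal_le_ofReal (norm_inner_le_norm _ _)
  · rw [inner_freeEvolution hst hf₁ hf₂ hh₁ hh₂]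
    refine (enorm_integral_le_lintegral_enorm _).trans ?_
    rw [← mul_assoc, eLpNorm_one_eq_lintegral_enorm (f := h),
      ← lintegral_const_mul'' _ hh₁.aestronglyMeasurable.enorm]
    refine lintegral_mono fun x => ?_
    rw [enorm_mul, RCLike.enorm_conj]
    gcongr
    exact enorm_schrodinger_le (sub_ne_zero.2 hst.symm) f x

lemma measurable_schrodinger {n : ℕ} {f : ℝ → Rn n → ℂ}
    (hf : Measurable fun q : ℝ × Rn n => f q.1 q.2) :
    Measurable fun q : (ℝ × ℝ) × Rn n => schrodinger n (q.1.1 - q.1.2) (f q.1.2) q.2 := by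
  unfold schrodinger
  refine Measurable.fun_mul (by fun_prop) (StronglyMeasurable.measurable ?_)
  refine StronglyMeasurable.integral_prod_right' (f := fun q : ((ℝ × ℝ) × Rn n) × Rn n =>
    Complex.exp (Complex.I * ((‖q.1.2 - q.2‖ : ℂ)) ^ 2 /
      (4 * ((q.1.1.1 - q.1.1.2 : ℝ) : ℂ))) * f q.1.1.2 q.2) (Measurable.stronglyMeasurable ?_)
  have h1 : Measurable fun q : ((ℝ × ℝ) × Rn n) × Rn n => f q.1.1.2 q.2 :=
    hf.comp (by fun_prop : Measurable fun q : ((ℝ × ℝ) × Rn n) × Rn n => (q.1.1.2, q.2))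
  refine Measurable.fun_mul ?_ h1
  fun_prop

/-- The coefficients of the function dual to a sequence `v` in `L^{1/α}(ℓ²)`, after rescaling to the
dyadic measure levels `2 ^ j`. -/
noncomputable def dualCoeff (p α : ℝ) (S : Finset ℤ) (v : ℤ → ℝ → ℝ≥0∞) (j : ℤ) (t : ℝ) : ℝ≥0∞ :=
  (∑ i ∈ S, v i t ^ 2) ^ ((1 / α - 2) / 2) * v j t * 2 ^ (-(j * (1 - 1 / p)) : ℝ)

lemma measurable_dualCoeff {p α : ℝ} {S : Finset ℤ} {v : ℤ → ℝ → ℝ≥0∞}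
    (hv : ∀ j, Measurable (v j)) (j : ℤ) : Measurable (dualCoeff p α S v j) := by
  unfold dualCoeff
  have := hv j
  fun_prop

lemma exists_dualCoeff_le {p α : ℝ} (hα : 0 < α) (hα' : α < 1 / 2) (S : Finset ℤ)
    {v : ℤ → ℝ → ℝ≥0∞} {K : ℝ≥0∞} (hK : K ≠ ∞) (hvK : ∀ j t, v j t ≤ K) (j : ℤ) :
    ∃ B : ℝ≥0∞, B ≠ ∞ ∧ ∀ t, dualCoeff p α S v j t ≤ B := by
  have h2 : 0 ≤ (1 / α - 2) / 2 := by
    have : 2 ≤ 1 / α := by rw [le_div_iff₀ hα]; linarith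
    linarith
  refine ⟨(∑ i ∈ S, K ^ 2) ^ ((1 / α - 2) / 2) * K * 2 ^ (-(j * (1 - 1 / p)) : ℝ), ?_, fun t => ?_⟩
  · refine ENNReal.mul_ne_top (ENNReal.mul_ne_top (ENNReal.rpow_ne_top_of_nonneg h2 ?_) hK)
      (ENNReal.rpow_ne_top_of_ne_zero (by norm_num) (by norm_num))
    exact ENNReal.sum_ne_top.2 fun i _ => ENNReal.pow_ne_top hK
  · unfold dualCoeff
    gcongr <;> exact hvK _ _

set_option maxHeartbeats 400000 in
lemma exists_enorm_integral_inner_freeEvolution_le {n : ℕ} {p α : ℝ} (hp : 2 < p)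
    (hα : α = n / 2 * (1 / 2 - 1 / p)) (hα0 : 0 < α) (hα' : α < 1 / 2) :
    ∃ C : ℝ≥0∞, C ≠ ∞ ∧ ∀ (S : Finset ℤ) (v : ℤ → ℝ → ℝ≥0∞) (K : ℝ≥0∞) (I : Set ℝ)
      (h : ℤ → ℝ → Rn n → ℂ) (h₁ : ∀ j t, Integrable (h j t)) (h₂ : ∀ j t, MemLp (h j t) 2),
      (∀ j, Measurable (v j)) → K ≠ ∞ → (∀ j t, v j t ≤ K) → MeasurableSet I → volume I ≠ ∞ →
      (∀ j, ∀ t ∉ I, v j t = 0) → (∀ j, Measurable fun q : ℝ × Rn n => h j q.1 q.2) →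
      (∀ j t, eLpNorm (h j t) 1 volume ≤ 2 ^ (j : ℝ)) →
      (∀ j t, eLpNorm (h j t) 2 volume ≤ 2 ^ (j / 2 : ℝ)) → ∀ f : L2 n,
      Integrable (fun t => inner ℂ (∑ j ∈ S, ((dualCoeff p α S v j t).toReal : ℂ) •
        freeEvolution (-t) ((h₂ j t).toLp (h j t))) f) ∧
      ‖∫ t, inner ℂ (∑ j ∈ S, ((dualCoeff p α S v j t).toReal : ℂ) •
        freeEvolution (-t) ((h₂ j t).toLp (h j t))) f‖ₑ ≤
      C * ‖f‖ₑ * (∫⁻ t, (∑ j ∈ S, v j t ^ 2) ^ (1 / (2 * α))) ^ (1 - α) := by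
  obtain ⟨C₁, hC₁, hker⟩ := exists_sum_sum_interpolated_kernel_le hp
  obtain ⟨C₂, hC₂, hhls⟩ := exists_lintegral_riesz_le hα0 hα'
  refine ⟨(C₁ * C₂) ^ (1 / 2 : ℝ), ENNReal.rpow_ne_top_of_nonneg (by norm_num)
    (ENNReal.mul_ne_top hC₁ hC₂), ?_⟩
  intro S v K I h h₁ h₂ hv hK hvK hI hI' hvI hm hh₁ hh₂ f
  have hα2 : 0 ≤ (1 / α - 2) / 2 := by
    have : 2 ≤ 1 / α := by rw [le_div_iff₀ hα0]; linarith
    linarith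
  set G : ℝ → L2 n := fun t => ∑ j ∈ S, ((dualCoeff p α S v j t).toReal : ℂ) •
    freeEvolution (-t) ((h₂ j t).toLp (h j t)) with hG
  set Q : ℝ → ℝ≥0∞ := fun t => ∑ j ∈ S, v j t ^ 2 with hQ
  have hQm : Measurable Q := by fun_prop
  have hQK : ∀ t, Q t ≤ ∑ j ∈ S, K ^ 2 := fun t => Finset.sum_le_sum fun j _ => by
    gcongr; exact hvK j t
  have hQK' : ∑ j ∈ S, K ^ 2 ≠ ∞ := ENNReal.sum_ne_top.2 fun i _ => ENNReal.pow_ne_top hK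
  have hQt : ∀ t, Q t ≠ ∞ := fun t => ne_top_of_le_ne_top hQK' (hQK t)
  choose B hB hbB using exists_dualCoeff_le (p := p) hα0 hα' S hK hvK
  have hbt : ∀ j t, dualCoeff p α S v j t ≠ ∞ := fun j t => ne_top_of_le_ne_top (hB j) (hbB j t)
  have hGm : ∀ f, Measurable fun t => inner ℂ (G t) f := fun f => by
    simp only [hG, sum_inner, inner_smul_left]
    refine Finset.measurable_sum _ fun j _ => Measurable.fun_mul ?_
      (measurable_inner_freeEvolution (hm j) (h₁ j) (h₂ j) f)
    have := (measurable_dualCoeff (p := p) (α := α) (S := S) hv j).ennreal_toReal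
    simp only [Complex.conj_ofReal]
    fun_prop
  set M : ℝ := ∑ j ∈ S, (B j).toReal * ((2 : ℝ≥0∞) ^ (j / 2 : ℝ)).toReal
  have hGB : ∀ t, ‖G t‖ ≤ I.indicator (fun _ => M) t := fun t => by
    by_cases ht : t ∈ I
    · rw [indicator_of_mem ht]
      refine (norm_sum_le _ _).trans (Finset.sum_le_sum fun j _ => ?_)
      rw [norm_smul, norm_freeEvolution, Lp.norm_toLp, Complex.norm_real, Real.norm_eq_abs,
        abs_of_nonneg toReal_nonneg]
      gcongr
      · exact hB j
      · exact hbB j t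
      · exact ENNReal.rpow_ne_top_of_ne_zero (by norm_num) (by norm_num)
      · exact hh₂ j t
    · rw [indicator_of_notMem ht]
      refine le_of_eq ?_
      rw [norm_eq_zero]
      refine Finset.sum_eq_zero fun j _ => ?_
      simp [dualCoeff, hvI j t ht]
  have hMi : Integrable (I.indicator fun _ => M) :=
    (integrable_indicator_iff hI).2 (integrableOn_const hI')
  refine ⟨(hMi.mul_const ‖f‖).mono' (hGm f).aestronglyMeasurable (.of_forall fun t =>
    (norm_inner_le_norm _ _).trans (by gcongr; exact hGB t)), ?_⟩
  have hpow : ∀ t, Q t ^ ((1 / α - 2) / 2) * Q t ^ (1 / 2 : ℝ) =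
      (Q t ^ (1 / (2 * α))) ^ (1 - α) := fun t => by
    rw [← ENNReal.rpow_add_of_nonneg _ _ hα2 (by norm_num), ← ENNReal.rpow_mul]
    congr 1
    field_simp
    ring
  have hkernel : ∀ s t, s ≠ t → ‖inner ℂ (G s) (G t)‖ₑ ≤ C₁ *
      ((Q t ^ (1 / (2 * α))) ^ (1 - α) * (Q s ^ (1 / (2 * α))) ^ (1 - α) *
        ENNReal.ofReal (|t - s| ^ (-(2 * α)))) := fun s t hst => by
    set D := ENNReal.ofReal (|t - s| ^ (-(n / 2 : ℝ)))
    have hts : 0 < |t - s| := abs_pos.2 (sub_ne_zero.2 hst.symm)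
    have hD0 : D ≠ 0 := (ENNReal.ofReal_pos.2 (by positivity)).ne'
    have hDα : D ^ (1 - 2 / p) = ENNReal.ofReal (|t - s| ^ (-(2 * α))) := by
      rw [ENNReal.ofReal_rpow_of_pos (by positivity), ← Real.rpow_mul hts.le, hα]
      congr 2
      ring
    have hterm : ∀ j l, ‖inner ℂ (((dualCoeff p α S v j s).toReal : ℂ) •
        freeEvolution (-s) ((h₂ j s).toLp (h j s))) (((dualCoeff p α S v l t).toReal : ℂ) •
        freeEvolution (-t) ((h₂ l t).toLp (h l t)))‖ₑ ≤
        Q s ^ ((1 / α - 2) / 2) * Q t ^ ((1 / α - 2) / 2) * (v j s * v l t *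
        ((2 : ℝ≥0∞) ^ (-((j + l : ℤ) * (1 - 1 / p)) : ℝ) *
        min ((2 : ℝ≥0∞) ^ ((j + l : ℤ) / 2 : ℝ)) (D * 2 ^ ((j + l : ℤ) : ℝ)))) := fun j l => by
      have e : ∀ j t, ‖((dualCoeff p α S v j t).toReal : ℂ)‖ₑ = dualCoeff p α S v j t :=
        fun j t => by
          rw [← ofReal_norm, Complex.norm_real, Real.norm_eq_abs, abs_of_nonneg toReal_nonneg,
            ENNReal.ofReal_toReal (hbt j t)]
      rw [inner_smul_left, inner_smul_right, enorm_mul, enorm_mul, RCLike.enorm_conj, e, e]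
      have hin : ‖inner ℂ (freeEvolution (-s) ((h₂ j s).toLp (h j s)))
          (freeEvolution (-t) ((h₂ l t).toLp (h l t)))‖ₑ ≤
          min ((2 : ℝ≥0∞) ^ ((j + l : ℤ) / 2 : ℝ)) (D * 2 ^ ((j + l : ℤ) : ℝ)) := by
        refine (enorm_inner_freeEvolution_le (neg_injective.ne hst.symm) (h₁ j s) (h₂ j s) (h₁ l t)
          (h₂ l t)).trans (min_le_min ?_ ?_)
        · refine (mul_le_mul' (hh₂ j s) (hh₂ l t)).trans_eq ?_
          rw [← ENNReal.rpow_add _ _ (by norm_num) (by norm_num)]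
          congr 1; push_cast; ring
        · rw [show -s - -t = t - s by ring]
          refine mul_le_mul' le_rfl ((mul_le_mul' (hh₁ j s) (hh₁ l t)).trans_eq ?_)
          rw [← ENNReal.rpow_add _ _ (by norm_num) (by norm_num)]
          congr 1; push_cast; ring
      calc _ ≤ dualCoeff p α S v j s * (dualCoeff p α S v l t *
            min ((2 : ℝ≥0∞) ^ ((j + l : ℤ) / 2 : ℝ)) (D * 2 ^ ((j + l : ℤ) : ℝ))) := by gcongr
        _ = _ := by
          have : (2 : ℝ≥0∞) ^ (-((j + l : ℤ) * (1 - 1 / p)) : ℝ) =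
              2 ^ (-(j * (1 - 1 / p)) : ℝ) * 2 ^ (-(l * (1 - 1 / p)) : ℝ) := by
            rw [← ENNReal.rpow_add _ _ (by norm_num) (by norm_num)]
            congr 1; push_cast; ring
          rw [this]
          simp only [dualCoeff, hQ]
          ring
    have hsum : ‖inner ℂ (G s) (G t)‖ₑ ≤ ∑ j ∈ S, ∑ l ∈ S, Q s ^ ((1 / α - 2) / 2) *
        Q t ^ ((1 / α - 2) / 2) *
          (v j s * v l t * ((2 : ℝ≥0∞) ^ (-((j + l : ℤ) * (1 - 1 / p)) : ℝ) *
          min ((2 : ℝ≥0∞) ^ ((j + l : ℤ) / 2 : ℝ)) (D * 2 ^ ((j + l : ℤ) : ℝ)))) := by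
      simp only [hG, sum_inner]
      refine (enorm_sum_le _ _).trans (Finset.sum_le_sum fun j _ => ?_)
      rw [inner_sum]
      exact (enorm_sum_le _ _).trans (Finset.sum_le_sum fun l _ => hterm j l)
    have hk := hker S (fun j => v j s) (fun j => v j t) D hD0 ofReal_ne_top
    simp_rw [← Finset.mul_sum] at hsum
    calc _ ≤ _ := hsum
      _ ≤ Q s ^ ((1 / α - 2) / 2) * Q t ^ ((1 / α - 2) / 2) * (C₁ * D ^ (1 - 2 / p) *
          (Q s ^ (1 / 2 : ℝ) * Q t ^ (1 / 2 : ℝ))) := mul_le_mul' le_rfl hk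
      _ = C₁ * ((Q t ^ ((1 / α - 2) / 2) * Q t ^ (1 / 2 : ℝ)) *
          (Q s ^ ((1 / α - 2) / 2) * Q s ^ (1 / 2 : ℝ)) * D ^ (1 - 2 / p)) := by ring
      _ = _ := by rw [hpow, hpow, hDα]
  set H : ℝ → ℝ≥0∞ := fun t => Q t ^ (1 / (2 * α))
  have hHm : Measurable H := by fun_prop
  have hHt : ∀ t, H t ≠ ∞ := fun t => ENNReal.rpow_ne_top_of_nonneg (by positivity) (hQt t)
  have hHi : ∫⁻ t, H t ≠ ∞ := by
    have : ∀ t, H t ≤ I.indicator (fun _ => (∑ j ∈ S, K ^ 2) ^ (1 / (2 * α))) t := fun t => by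
      by_cases ht : t ∈ I
      · rw [indicator_of_mem ht]
        exact ENNReal.rpow_le_rpow (hQK t) (by positivity)
      · rw [indicator_of_notMem ht]
        have : Q t = 0 := Finset.sum_eq_zero fun j _ => by simp [hvI j t ht]
        simp only [H, this]
        rw [ENNReal.zero_rpow_of_pos (by positivity)]
    refine ne_top_of_le_ne_top ?_ (lintegral_mono this)
    rw [lintegral_indicator hI, setLIntegral_const]
    exact ENNReal.mul_ne_top (ENNReal.rpow_ne_top_of_nonneg (by positivity) hQK') hI'
  have hsq := enorm_integral_inner_sq_le (fun f => (hGm f).aemeasurable) hMi hGB f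
  have hdouble : ∫⁻ t, ∫⁻ s, ‖inner ℂ (G s) (G t)‖ₑ ≤
      C₁ * (C₂ * (∫⁻ t, H t) ^ (2 - 2 * α)) := by
    calc _ ≤ ∫⁻ t, ∫⁻ s, C₁ * (H t ^ (1 - α) * H s ^ (1 - α) *
          ENNReal.ofReal (|t - s| ^ (-(2 * α)))) := by
          refine lintegral_mono fun t => lintegral_mono_ae ?_
          filter_upwards [volume.ae_ne t] with s hst
          exact hkernel s t hst
      _ = C₁ * ∫⁻ t, ∫⁻ s, H t ^ (1 - α) * H s ^ (1 - α) *
          ENNReal.ofReal (|t - s| ^ (-(2 * α))) := by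
          simp_rw [lintegral_const_mul' _ _ hC₁]
      _ ≤ _ := by gcongr; exact hhls H hHm hHt hHi
  have hfin := hsq.trans (mul_le_mul' le_rfl hdouble)
  have := ENNReal.rpow_le_rpow hfin (by norm_num : (0 : ℝ) ≤ 1 / 2)
  have hroot : ∀ x : ℝ≥0∞, (x ^ 2) ^ (1 / 2 : ℝ) = x := fun x => by
    rw [← ENNReal.rpow_natCast, ← ENNReal.rpow_mul]; simp
  rw [hroot] at this
  refine this.trans_eq ?_
  rw [ENNReal.mul_rpow_of_nonneg _ _ (by norm_num), hroot, ← mul_assoc C₁,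
    ENNReal.mul_rpow_of_nonneg _ _ (by norm_num), ← ENNReal.rpow_mul,
    show (2 - 2 * α) * (1 / 2) = 1 - α by ring]
  ring

lemma conj_mul_div_norm (z : ℂ) : conj z * (z / ‖z‖) = ‖z‖ := by
  rcases eq_or_ne z 0 with rfl | hz
  · simp
  · have : (‖z‖ : ℂ) ≠ 0 := by simpa using hz
    rw [← mul_div_assoc, ← Complex.normSq_eq_conj_mul_self, Complex.normSq_eq_norm_sq]
    push_cast
    field_simp

lemma enorm_div_norm_le (z : ℂ) : ‖z / ‖z‖‖ₑ ≤ 1 := by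
  rw [← ofReal_norm, ← ENNReal.ofReal_one]
  apply ENNReal.ofReal_le_ofReal
  rw [norm_div, Complex.norm_real, norm_norm]
  exact div_self_le_one _

lemma measurable_schrodinger_sub_const {n : ℕ} {g : Rn n → ℂ} (hg : Measurable g) (τ : ℝ) :
    Measurable fun q : ℝ × Rn n => schrodinger n (q.1 - τ) g q.2 := by
  have h := measurable_schrodinger (n := n) (f := fun _ => g) (hg.comp measurable_snd)
  have h' : Measurable fun q : ℝ × Rn n => ((q.1, τ), q.2) :=
    (measurable_fst.prodMk measurable_const).prodMk measurable_snd
  simpa only [Function.comp_def] using h.comp h'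

lemma exists_lintegral_dualCoeff_mul_schrodinger_le {n : ℕ} {p α : ℝ} (hp : 2 < p)
    (hα : α = n / 2 * (1 / 2 - 1 / p)) (hα0 : 0 < α) (hα' : α < 1 / 2) :
    ∃ C : ℝ≥0∞, C ≠ ∞ ∧ ∀ (S : Finset ℤ) (v : ℤ → ℝ → ℝ≥0∞) (K : ℝ≥0∞) (I : Set ℝ)
      (W : ℤ → ℝ → Rn n → ℝ≥0∞),
      (∀ j, Measurable (v j)) → K ≠ ∞ → (∀ j t, v j t ≤ K) → MeasurableSet I → volume I ≠ ∞ →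
      (∀ j, ∀ t ∉ I, v j t = 0) → (∀ j, Measurable fun q : ℝ × Rn n => W j q.1 q.2) →
      (∀ j t x, W j t x ≠ ∞) → (∀ j t, ∫⁻ x, W j t x ≤ 2 ^ (j : ℝ)) →
      (∀ j t, ∫⁻ x, W j t x ^ 2 ≤ 2 ^ (j : ℝ)) →
      ∀ g : Rn n → ℂ, Measurable g → Integrable g → MemLp g 2 → ∀ τ : ℝ,
      ∫⁻ t, ∑ j ∈ S, dualCoeff p α S v j t * ∫⁻ x, W j t x * ‖schrodinger n (t - τ) g x‖ₑ ≤
        C * eLpNorm g 2 volume * (∫⁻ t, (∑ j ∈ S, v j t ^ 2) ^ (1 / (2 * α))) ^ (1 - α) := by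
  obtain ⟨C, hC, hmain⟩ := exists_enorm_integral_inner_freeEvolution_le (n := n) hp hα hα0 hα'
  refine ⟨C, hC, ?_⟩
  intro S v K I W hv hK hvK hI hI' hvI hW hWt hW₁ hW₂ g hg hg₁ hg₂ τ
  obtain ⟨z, hzg⟩ : ∃ z : ℝ → Rn n → ℂ, z = fun t => schrodinger n (t - τ) g := ⟨_, rfl⟩
  have hz : Measurable fun q : ℝ × Rn n => z q.1 q.2 := by
    rw [hzg]
    exact measurable_schrodinger_sub_const hg τ
  obtain ⟨h, hh⟩ : ∃ h : ℤ → ℝ → Rn n → ℂ,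
      h = fun j t x => ((W j t x).toReal : ℂ) * (z t x / ‖z t x‖) := ⟨_, rfl⟩
  have hm : ∀ j, Measurable fun q : ℝ × Rn n => h j q.1 q.2 := fun j => by
    have := (hW j).ennreal_toReal
    rw [hh]
    fun_prop
  have hmx : ∀ j t, Measurable (h j t) := fun j t =>
    (hm j).comp (by fun_prop : Measurable fun x : Rn n => (t, x))
  have hWx : ∀ j t, Measurable (W j t) := fun j t =>
    (hW j).comp (by fun_prop : Measurable fun x : Rn n => (t, x))
  have hle : ∀ j t x, ‖h j t x‖ₑ ≤ W j t x := fun j t x => by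
    rw [hh, enorm_mul, ← ofReal_norm, Complex.norm_real, Real.norm_eq_abs,
      abs_of_nonneg toReal_nonneg, ENNReal.ofReal_toReal (hWt j t x)]
    exact mul_le_of_le_one_right' (enorm_div_norm_le _)
  have hh₁ : ∀ j t, eLpNorm (h j t) 1 volume ≤ 2 ^ (j : ℝ) := fun j t => by
    rw [eLpNorm_one_eq_lintegral_enorm]
    exact (lintegral_mono (hle j t)).trans (hW₁ j t)
  have hh₂ : ∀ j t, eLpNorm (h j t) 2 volume ≤ 2 ^ (j / 2 : ℝ) := fun j t => by
    rw [eLpNorm_eq_lintegral_rpow_enorm_toReal (by norm_num) (by norm_num)]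
    calc _ ≤ ((2 : ℝ≥0∞) ^ (j : ℝ)) ^ (1 / (2 : ℝ≥0∞).toReal) := by
          gcongr
          refine le_trans (lintegral_mono fun x => ?_) (hW₂ j t)
          rw [ENNReal.toReal_ofNat, ENNReal.rpow_ofNat]
          gcongr
          exact hle j t x
      _ = _ := by rw [← ENNReal.rpow_mul]; congr 1; simp; ring
  have h₁ : ∀ j t, Integrable (h j t) := fun j t => by
    rw [← memLp_one_iff_integrable]
    exact ⟨(hmx j t).aestronglyMeasurable, (hh₁ j t).trans_lt
      (Ne.lt_top <| ENNReal.rpow_ne_top_of_ne_zero (by norm_num) (by norm_num))⟩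
  have h₂ : ∀ j t, MemLp (h j t) 2 := fun j t =>
    ⟨(hmx j t).aestronglyMeasurable, (hh₂ j t).trans_lt
      (Ne.lt_top <| ENNReal.rpow_ne_top_of_ne_zero (by norm_num) (by norm_num))⟩
  obtain ⟨hint, hbd⟩ := hmain S v K I h h₁ h₂ hv hK hvK hI hI' hvI hm hh₁ hh₂
    (freeEvolution (-τ) (hg₂.toLp g))
  obtain ⟨r, hr⟩ : ∃ r : ℤ → ℝ → ℝ, r = fun j t => ∫ x, (W j t x).toReal * ‖z t x‖ := ⟨_, rfl⟩
  obtain ⟨X, hXr⟩ : ∃ X : ℝ → ℝ,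
      X = fun t => ∑ j ∈ S, (dualCoeff p α S v j t).toReal * r j t := ⟨_, rfl⟩
  have hr0 : ∀ j t, 0 ≤ r j t := fun j t => by
    rw [hr]
    exact integral_nonneg fun x => by positivity
  have hX0 : ∀ t, 0 ≤ X t := fun t => by
    rw [hXr]
    exact Finset.sum_nonneg fun j _ =>
    mul_nonneg toReal_nonneg (hr0 j t)
  have hX : ∀ t, t ≠ τ → inner ℂ (∑ j ∈ S, ((dualCoeff p α S v j t).toReal : ℂ) •
      freeEvolution (-t) ((h₂ j t).toLp (h j t))) (freeEvolution (-τ) (hg₂.toLp g)) =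
      (X t : ℂ) := fun t ht => by
    simp only [hXr, hr, sum_inner, inner_smul_left, Complex.conj_ofReal, Complex.ofReal_sum,
      Complex.ofReal_mul]
    refine Finset.sum_congr rfl fun j _ => ?_
    congr 1
    rw [← inner_conj_symm, inner_freeEvolution (neg_injective.ne ht) hg₁ hg₂ (h₁ j t) (h₂ j t),
      show -τ - -t = t - τ by ring]
    have : ∀ x, conj (schrodinger n (t - τ) g x) * h j t x =
        (((W j t x).toReal * ‖z t x‖ : ℝ) : ℂ) := fun x => by
      rw [show schrodinger n (t - τ) g x = z t x by rw [hzg], hh, mul_left_comm, conj_mul_div_norm]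
      push_cast; rfl
    simp_rw [this]
    rw [integral_complex_ofReal, Complex.conj_ofReal]
  have hne : ∀ᵐ t : ℝ, t ≠ τ := volume.ae_ne τ
  have hα2 : 0 ≤ (1 / α - 2) / 2 := by
    have : 2 ≤ 1 / α := by rw [le_div_iff₀ hα0]; linarith
    linarith
  have hbt : ∀ j t, dualCoeff p α S v j t ≠ ∞ := fun j t => by
    obtain ⟨B, hB, hbB⟩ := exists_dualCoeff_le (p := p) hα0 hα' S hK hvK j
    exact ne_top_of_le_ne_top hB (hbB t)
  have hlhs : ∀ t, t ≠ τ → ∑ j ∈ S, dualCoeff p α S v j t *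
      ∫⁻ x, W j t x * ‖schrodinger n (t - τ) g x‖ₑ = ENNReal.ofReal (X t) := fun t ht => by
    rw [hXr, ENNReal.ofReal_sum_of_nonneg fun j _ => mul_nonneg toReal_nonneg (hr0 j t)]
    refine Finset.sum_congr rfl fun j _ => ?_
    rw [ENNReal.ofReal_mul toReal_nonneg, ENNReal.ofReal_toReal (hbt j t)]
    congr 1
    have hzt : Measurable (z t) := hz.comp (by fun_prop : Measurable fun x : Rn n => (t, x))
    have hWz : ∀ x, W j t x * ‖schrodinger n (t - τ) g x‖ₑ =
        ENNReal.ofReal ((W j t x).toReal * ‖z t x‖) := fun x => by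
      rw [ENNReal.ofReal_mul toReal_nonneg, ENNReal.ofReal_toReal (hWt j t x), ofReal_norm, hzg]
    rw [hr]
    rw [ofReal_integral_eq_lintegral_ofReal _ (.of_forall fun x => by positivity)]
    · exact lintegral_congr hWz
    · refine ⟨by have := (hWx j t).ennreal_toReal; fun_prop, ?_⟩
      rw [hasFiniteIntegral_iff_ofReal (.of_forall fun x => by positivity)]
      simp_rw [← hWz]
      calc _ ≤ ∫⁻ x, W j t x * (ENNReal.ofReal (|t - τ| ^ (-(n / 2 : ℝ))) *
            eLpNorm g 1 volume) := by
            gcongr with x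
            exact enorm_schrodinger_le (sub_ne_zero.2 ht) g x
        _ = (∫⁻ x, W j t x) * (ENNReal.ofReal (|t - τ| ^ (-(n / 2 : ℝ))) *
            eLpNorm g 1 volume) := lintegral_mul_const _ (hWx j t)
        _ < ∞ := ENNReal.mul_lt_top ((hW₁ j t).trans_lt
            (Ne.lt_top <| ENNReal.rpow_ne_top_of_ne_zero (by norm_num) (by norm_num)))
            (ENNReal.mul_lt_top ofReal_lt_top (memLp_one_iff_integrable.2 hg₁).2)
  have hXi : Integrable X := by
    have : Integrable fun t => (X t : ℂ) := hint.congr (hne.mono hX)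
    simpa using this.re
  calc _ = ∫⁻ t, ENNReal.ofReal (X t) := lintegral_congr_ae (hne.mono hlhs)
    _ = ENNReal.ofReal (∫ t, X t) :=
        (ofReal_integral_eq_lintegral_ofReal hXi (.of_forall hX0)).symm
    _ = ‖∫ t, (X t : ℂ)‖ₑ := by
        rw [integral_complex_ofReal, ← ofReal_norm, Complex.norm_real, Real.norm_eq_abs,
          abs_of_nonneg (integral_nonneg hX0)]
    _ ≤ _ := by
        rw [integral_congr_ae (hne.mono hX)] at hbd
        refine hbd.trans_eq ?_
        rw [← ofReal_norm, norm_freeEvolution, ofReal_norm, Lp.enorm_toLp]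

/-- The dyadic rearrangement of `g` restricted to the ball of radius `M`, using only the levels
`2 ^ k` with `|k| ≤ M`. -/
noncomputable def truncatedRearrangement {n : ℕ} (M : ℕ) (g : Rn n → ℝ≥0∞) (j : ℤ) : ℝ≥0∞ :=
  (Finset.Icc (-M : ℤ) M).sup fun k =>
    if (2 : ℝ≥0∞) ^ j < volume (Metric.ball 0 M ∩ {x | (2 : ℝ≥0∞) ^ k < g x}) then 2 ^ k else 0

lemma truncatedRearrangement_le {n : ℕ} (M : ℕ) (g : Rn n → ℝ≥0∞) (j : ℤ) :
    truncatedRearrangement M g j ≤ 2 ^ (M : ℤ) := by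
  refine Finset.sup_le fun k hk => ?_
  split_ifs
  · exact ENNReal.zpow_le_of_le (by norm_num) (Finset.mem_Icc.1 hk).2
  · exact zero_le

lemma truncatedRearrangement_mono {n : ℕ} (g : Rn n → ℝ≥0∞) (j : ℤ) :
    Monotone fun M => truncatedRearrangement M g j := by
  intro M N h
  refine Finset.sup_le fun k hk => ?_
  have hk' : k ∈ Finset.Icc (-N : ℤ) N := by
    rw [Finset.mem_Icc] at hk ⊢
    omega
  refine le_trans ?_ (Finset.le_sup (f := fun k => if (2 : ℝ≥0∞) ^ j <
    volume (Metric.ball 0 N ∩ {x | (2 : ℝ≥0∞) ^ k < g x}) then (2 : ℝ≥0∞) ^ k else 0) hk')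
  split_ifs with h₁ h₂
  · exact le_rfl
  · refine absurd (h₁.trans_le (measure_mono ?_)) h₂
    gcongr
  · exact zero_le
  · exact le_rfl

lemma iSup_truncatedRearrangement {n : ℕ} (g : Rn n → ℝ≥0∞) (j : ℤ) :
    dyadicRearrangement volume g j ≤ ⨆ M, truncatedRearrangement M g j := by
  refine iSup_le fun k => ?_
  split_ifs with h
  · have hU : {x | (2 : ℝ≥0∞) ^ k < g x} =
        ⋃ M : ℕ, Metric.ball 0 M ∩ {x | (2 : ℝ≥0∞) ^ k < g x} := by
      rw [← iUnion_inter, Metric.iUnion_ball_nat, univ_inter]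
    have hmono : Monotone fun M : ℕ => Metric.ball (0 : Rn n) M ∩ {x | (2 : ℝ≥0∞) ^ k < g x} :=
      fun a b hab => by
        dsimp only
        gcongr
    rw [hU, hmono.measure_iUnion, lt_iSup_iff] at h
    obtain ⟨M, hM⟩ := h
    refine le_iSup_of_le (max M k.natAbs) ?_
    refine le_trans ?_ (Finset.le_sup (b := k) ?_)
    · rw [if_pos]
      exact hM.trans_le (measure_mono (hmono (le_max_left _ _)))
    · rw [Finset.mem_Icc]
      omega
  · exact zero_le

lemma zpow_le_volume_of_truncatedRearrangement_ne_zero {n M : ℕ} {g : Rn n → ℝ≥0∞} {j : ℤ}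
    (h : truncatedRearrangement M g j ≠ 0) :
    (2 : ℝ≥0∞) ^ j ≤ volume (Metric.ball 0 M ∩ {x | truncatedRearrangement M g j ≤ g x}) := by
  obtain ⟨k, -, hk⟩ := Finset.exists_mem_eq_sup (Finset.Icc (-M : ℤ) M) ⟨0, by simp⟩ fun k =>
    if (2 : ℝ≥0∞) ^ j < volume (Metric.ball 0 M ∩ {x | (2 : ℝ≥0∞) ^ k < g x})
    then (2 : ℝ≥0∞) ^ k else 0
  change truncatedRearrangement M g j = _ at hk
  split_ifs at hk with h'
  · rw [hk]
    refine h'.le.trans (measure_mono (inter_subset_inter_right _ fun x hx => ?_))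
    exact le_of_lt (mem_ofPred.1 hx)
  · exact absurd hk h

lemma measurable_truncatedRearrangement {n : ℕ} {G : ℝ → Rn n → ℝ≥0∞}
    (hG : Measurable fun q : ℝ × Rn n => G q.1 q.2) (M : ℕ) (j : ℤ) :
    Measurable fun t => truncatedRearrangement M (G t) j := by
  simp only [truncatedRearrangement, Finset.sup_eq_iSup]
  refine .iSup fun k => .iSup fun _ => Measurable.ite ?_ measurable_const measurable_const
  have hs : MeasurableSet {q : ℝ × Rn n | q.2 ∈ Metric.ball 0 M ∧ (2 : ℝ≥0∞) ^ k < G q.1 q.2} :=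
    (measurable_snd Metric.isOpen_ball.measurableSet).inter (measurableSet_lt measurable_const hG)
  exact measurableSet_lt measurable_const (measurable_measure_prodMk_left hs)

lemma exists_weight {n : ℕ} {G : ℝ → Rn n → ℝ≥0∞}
    (hG : Measurable fun q : ℝ × Rn n => G q.1 q.2) (M : ℕ) :
    ∃ W : ℤ → ℝ → Rn n → ℝ≥0∞, (∀ j, Measurable fun q : ℝ × Rn n => W j q.1 q.2) ∧
      (∀ j t x, W j t x ≠ ∞) ∧ (∀ j t, ∫⁻ x, W j t x ≤ 2 ^ (j : ℝ)) ∧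
      (∀ j t, ∫⁻ x, W j t x ^ 2 ≤ 2 ^ (j : ℝ)) ∧
      ∀ j t, truncatedRearrangement M (G t) j * 2 ^ (j : ℝ) ≤ ∫⁻ x, W j t x * G t x := by
  obtain ⟨E, hE⟩ : ∃ E : ℤ → ℝ → Set (Rn n), E = fun j t =>
    Metric.ball 0 M ∩ {x | truncatedRearrangement M (G t) j ≤ G t x} := ⟨_, rfl⟩
  have hGx : ∀ t, Measurable (G t) := fun t => hG.comp measurable_prodMk_left
  have hEm : ∀ j, MeasurableSet {q : ℝ × Rn n | q.2 ∈ E j q.1} := fun j => by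
    rw [hE]
    exact (measurable_snd Metric.isOpen_ball.measurableSet).inter (measurableSet_le
      ((measurable_truncatedRearrangement hG M j).comp measurable_fst) hG)
  have hEx : ∀ j t, MeasurableSet (E j t) := fun j t => measurable_prodMk_left (hEm j)
  have hvol : ∀ j : ℤ, Measurable fun t => volume (E j t) := fun j =>
    measurable_measure_prodMk_left (hEm j)
  obtain ⟨w, hw⟩ : ∃ w : ℤ → ℝ → ℝ≥0∞, w = fun (j : ℤ) t =>
    min 1 (2 ^ (j : ℝ) / volume (E j t)) := ⟨_, rfl⟩
  have hw1 : ∀ j t, w j t ≤ 1 := fun j t => by rw [hw]; exact min_le_left _ _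
  have hi : ∀ j t, ∫⁻ x, (E j t).indicator (fun _ => w j t) x ≤ 2 ^ (j : ℝ) := fun j t => by
    rw [lintegral_indicator (hEx j t), setLIntegral_const]
    calc _ ≤ 2 ^ (j : ℝ) / volume (E j t) * volume (E j t) := by
          rw [hw]
          gcongr
          exact min_le_right _ _
      _ ≤ _ := ENNReal.mul_le_of_le_div le_rfl
  have hle1 : ∀ j t x, (E j t).indicator (fun _ => w j t) x ≤ 1 := fun j t x =>
    indicator_le' (f := fun _ => w j t) (g := 1) (fun _ _ => hw1 j t) (fun _ _ => zero_le) x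
  refine ⟨fun j t => (E j t).indicator fun _ => w j t, fun j => ?_,
    fun j t x => ne_top_of_le_ne_top one_ne_top (hle1 j t x), hi, fun j t => ?_, fun j t => ?_⟩
  · have : Measurable fun q : ℝ × Rn n => w j q.1 := by
      have := hvol j
      rw [hw]
      exact (measurable_const.min (measurable_const.div (hvol j))).comp measurable_fst
    exact this.indicator (hEm j)
  · refine le_trans (lintegral_mono fun x => ?_) (hi j t)
    rw [pow_two]
    exact mul_le_of_le_one_right' (hle1 j t x)
  · rcases eq_or_ne (truncatedRearrangement M (G t) j) 0 with h0 | h0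
    · simp [h0]
    have hEl : 2 ^ (j : ℝ) ≤ volume (E j t) := by
      rw [hE, ENNReal.rpow_intCast]
      exact zpow_le_volume_of_truncatedRearrangement_ne_zero h0
    have hE0 : volume (E j t) ≠ 0 :=
      (lt_of_lt_of_le (ENNReal.rpow_pos (by norm_num) (by norm_num)) hEl).ne'
    have hEt : volume (E j t) ≠ ∞ := by
      rw [hE]
      exact ne_top_of_le_ne_top Metric.isBounded_ball.measure_lt_top.ne
        (measure_mono inter_subset_left)
    have hwE : w j t * volume (E j t) = 2 ^ (j : ℝ) := by
      rw [hw]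
      dsimp only
      rw [min_eq_right (ENNReal.div_le_of_le_mul (by simpa using hEl)),
        ENNReal.div_mul_cancel hE0 hEt]
    calc _ = ∫⁻ x in E j t, w j t * truncatedRearrangement M (G t) j := by
          rw [setLIntegral_const, ← hwE]
          ring
      _ ≤ ∫⁻ x in E j t, w j t * G t x := by
          refine setLIntegral_mono' (hEx j t) fun x hx => ?_
          rw [hE] at hx
          gcongr
          exact hx.2
      _ = _ := by
          rw [← lintegral_indicator (hEx j t)]
          congr 1 with x
          by_cases hx : x ∈ E j t <;> simp [hx]

/-- A pointwise majorant of the Duhamel integral on `[0, T)`. -/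
noncomputable def duhamelMajorant (n : ℕ) (T : ℝ) (f : ℝ → Rn n → ℂ) (t : ℝ) (x : Rn n) : ℝ≥0∞ :=
  ∫⁻ τ in Ico 0 T, ‖schrodinger n (t - τ) (f τ) x‖ₑ

lemma enorm_duhamel_le {n : ℕ} {T t : ℝ} (ht : t ∈ Ico 0 T) (f : ℝ → Rn n → ℂ) (x : Rn n) :
    ‖duhamel n 0 f t x‖ₑ ≤ duhamelMajorant n T f t x := by
  rw [duhamel, intervalIntegral.integral_of_le ht.1]
  exact (enorm_integral_le_lintegral_enorm _).trans
    (lintegral_mono_set fun τ hτ => ⟨hτ.1.le, hτ.2.trans_lt ht.2⟩)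

lemma measurable_enorm_schrodinger {n : ℕ} {f : ℝ → Rn n → ℂ}
    (hf : Measurable fun q : ℝ × Rn n => f q.1 q.2) :
    Measurable fun q : (ℝ × ℝ) × Rn n => ‖schrodinger n (q.1.1 - q.1.2) (f q.1.2) q.2‖ₑ :=
  (measurable_schrodinger hf).enorm

lemma measurable_duhamelMajorant {n : ℕ} (T : ℝ) {f : ℝ → Rn n → ℂ}
    (hf : Measurable fun q : ℝ × Rn n => f q.1 q.2) :
    Measurable fun q : ℝ × Rn n => duhamelMajorant n T f q.1 q.2 := by
  have h : Measurable fun r : (ℝ × Rn n) × ℝ => ((r.1.1, r.2), r.1.2) := by fun_prop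
  have h' := (measurable_enorm_schrodinger hf).comp h
  exact Measurable.lintegral_prod_right' h'

lemma schrodinger_of_not_integrable {n : ℕ} {f : Rn n → ℂ} (hf : Measurable f)
    (h : ¬ Integrable f) (r : ℝ) (x : Rn n) : schrodinger n r f x = 0 := by
  rw [schrodinger, integral_undef, mul_zero]
  refine fun hi => h ?_
  rw [← integrable_norm_iff hf.aestronglyMeasurable]
  refine hi.norm.congr (.of_forall fun y => ?_)
  have : Complex.I * (‖x - y‖ : ℂ) ^ 2 / (4 * (r : ℂ)) =
      ((‖x - y‖ ^ 2 / (4 * r) : ℝ) : ℂ) * Complex.I := by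
    push_cast; ring
  simp only [norm_mul]
  rw [this, Complex.norm_exp_ofReal_mul_I, one_mul]

lemma measurable_eLpNorm_two {n : ℕ} {f : ℝ → Rn n → ℂ}
    (hf : Measurable fun q : ℝ × Rn n => f q.1 q.2) :
    Measurable fun τ => eLpNorm (f τ) 2 volume := by
  simp_rw [eLpNorm_eq_lintegral_rpow_enorm_toReal two_ne_zero ofNat_ne_top]
  exact ((hf.enorm.pow_const _).lintegral_prod_right').pow_const _

lemma rpow_le_of_le_mul_rpow {α : ℝ} (hα0 : 0 < α) {A B : ℝ≥0∞} (hA : A ≠ ∞)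
    (h : A ≤ B * A ^ (1 - α)) : A ^ α ≤ B := by
  rcases eq_or_ne A 0 with rfl | h0
  · rw [ENNReal.zero_rpow_of_pos hα0]
    exact zero_le
  have h1 : A ^ (1 - α) ≠ 0 := (ENNReal.rpow_pos (pos_iff_ne_zero.2 h0) hA).ne'
  have h2 : A ^ (1 - α) ≠ ∞ := ENNReal.rpow_ne_top_of_ne_zero h0 hA
  refine (ENNReal.mul_le_mul_iff_left h1 h2).1 (le_trans (le_of_eq ?_) h)
  rw [← ENNReal.rpow_add _ _ h0 hA]
  simp

lemma dualCoeff_mul_rpow {p α : ℝ} (hα0 : 0 < α) (hα' : α < 1 / 2) (S : Finset ℤ)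
    {v L : ℤ → ℝ → ℝ≥0∞} {I : Set ℝ}
    (hv : ∀ j ∈ S, v j = I.indicator fun t => (2 : ℝ≥0∞) ^ (j / p : ℝ) * L j t) (t : ℝ) :
    (∑ j ∈ S, v j t ^ 2) ^ (1 / (2 * α)) =
      ∑ j ∈ S, dualCoeff p α S v j t * I.indicator (fun t => L j t * 2 ^ (j : ℝ)) t := by
  have hα2 : 0 ≤ (1 / α - 2) / 2 := by
    have : 2 ≤ 1 / α := by rw [le_div_iff₀ hα0]; linarith
    linarith
  calc _ = (∑ j ∈ S, v j t ^ 2) ^ ((1 / α - 2) / 2) * ∑ j ∈ S, v j t ^ 2 := by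
        nth_rw 3 [← ENNReal.rpow_one (∑ j ∈ S, v j t ^ 2)]
        rw [← ENNReal.rpow_add_of_nonneg _ _ hα2 zero_le_one]
        congr 1
        field_simp
        ring
    _ = _ := by
        rw [Finset.mul_sum]
        refine Finset.sum_congr rfl fun j hj => ?_
        simp only [dualCoeff]
        by_cases ht : t ∈ I
        · have h2 : (2 : ℝ≥0∞) ^ (j / p : ℝ) = 2 ^ (-(j * (1 - 1 / p)) : ℝ) * 2 ^ (j : ℝ) := by
            rw [← ENNReal.rpow_add _ _ (by norm_num) (by norm_num)]
            congr 1; ring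
          have hvj : v j t = 2 ^ (j / p : ℝ) * L j t := by rw [hv j hj, indicator_of_mem ht]
          rw [indicator_of_mem ht, pow_two]
          nth_rw 2 [hvj]
          rw [h2]
          ring
        · have hvj : v j t = 0 := by rw [hv j hj, indicator_of_notMem ht]
          simp [hvj]

lemma exists_lintegral_truncated_le {n : ℕ} {p α : ℝ} (hp : 2 < p)
    (hα : α = n / 2 * (1 / 2 - 1 / p)) (hα0 : 0 < α) (hα' : α < 1 / 2) :
    ∃ C : ℝ≥0∞, C ≠ ∞ ∧ ∀ (T : ℝ) (f : ℝ → Rn n → ℂ),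
      Measurable (fun q : ℝ × Rn n => f q.1 q.2) →
      ∫⁻ τ in Ico 0 T, eLpNorm (f τ) 2 volume ≠ ∞ → ∀ M : ℕ,
      (∫⁻ t in Ico 0 T, (∑ j ∈ Finset.Icc (-M : ℤ) M, ((2 : ℝ≥0∞) ^ (j / p : ℝ) *
        truncatedRearrangement M (duhamelMajorant n T f t) j) ^ 2) ^ (1 / (2 * α))) ^ α ≤
      C * ∫⁻ τ in Ico 0 T, eLpNorm (f τ) 2 volume := by
  obtain ⟨C, hC, hmain⟩ := exists_lintegral_dualCoeff_mul_schrodinger_le (n := n) hp hα hα0 hα'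
  refine ⟨C, hC, fun T f hf hfin M => ?_⟩
  obtain ⟨S, hS⟩ : ∃ S, S = Finset.Icc (-M : ℤ) M := ⟨_, rfl⟩
  obtain ⟨I, hI⟩ : ∃ I, I = Ico 0 T := ⟨_, rfl⟩
  have hIm : MeasurableSet I := hI ▸ measurableSet_Ico
  have hIt : volume I ≠ ∞ := by rw [hI]; simp
  have hG := measurable_duhamelMajorant T hf
  obtain ⟨W, hW, hWt, hW₁, hW₂, hWG⟩ := exists_weight hG M
  obtain ⟨L, hL⟩ : ∃ L : ℤ → ℝ → ℝ≥0∞,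
      L = fun j t => truncatedRearrangement M (duhamelMajorant n T f t) j := ⟨_, rfl⟩
  have hLm : ∀ j, Measurable (L j) := fun j => hL ▸ measurable_truncatedRearrangement hG M j
  obtain ⟨v, hv⟩ : ∃ v : ℤ → ℝ → ℝ≥0∞, v = fun (j : ℤ) =>
      if j ∈ S then I.indicator fun t => (2 : ℝ≥0∞) ^ (j / p : ℝ) * L j t else 0 := ⟨_, rfl⟩
  have hvS : ∀ j ∈ S, v j = I.indicator fun t => (2 : ℝ≥0∞) ^ (j / p : ℝ) * L j t :=
    fun j hj => by rw [hv]; exact if_pos hj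
  have hvS' : ∀ j ∉ S, v j = 0 := fun j hj => by rw [hv]; exact if_neg hj
  have hvm : ∀ j, Measurable (v j) := fun j => by
    by_cases hj : j ∈ S
    · rw [hvS j hj]
      exact ((hLm j).const_mul _).indicator hIm
    · rw [hvS' j hj]
      exact measurable_const
  have hvI : ∀ j, ∀ t ∉ I, v j t = 0 := fun j t ht => by
    by_cases hj : j ∈ S
    · rw [hvS j hj, indicator_of_notMem ht]
    · rw [hvS' j hj]; rfl
  obtain ⟨K, hK⟩ : ∃ K : ℝ≥0∞, K = ∑ j ∈ S, (2 : ℝ≥0∞) ^ (j / p : ℝ) * 2 ^ (M : ℤ) := ⟨_, rfl⟩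
  have hKt : K ≠ ∞ := by
    rw [hK]
    refine ENNReal.sum_ne_top.2 fun j _ => ENNReal.mul_ne_top
      (ENNReal.rpow_ne_top_of_ne_zero (by norm_num) (by norm_num)) ?_
    exact ENNReal.zpow_ne_top (by norm_num) (by norm_num) _
  have hvK : ∀ j t, v j t ≤ K := fun j t => by
    by_cases hj : j ∈ S
    · rw [hvS j hj, hK]
      refine le_trans (indicator_le_self _ _ t) (le_trans ?_ (Finset.single_le_sum
        (f := fun j : ℤ => (2 : ℝ≥0∞) ^ (j / p : ℝ) * 2 ^ (M : ℤ)) (fun _ _ => zero_le) hj))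
      gcongr
      rw [hL]
      exact truncatedRearrangement_le M _ j
    · rw [hvS' j hj]
      exact zero_le
  have hbound := hmain S v K I W hvm hKt hvK hIm hIt hvI hW hWt hW₁ hW₂
  obtain ⟨Q, hQ⟩ : ∃ Q : ℝ → ℝ≥0∞, Q = fun t => (∑ j ∈ S, v j t ^ 2) ^ (1 / (2 * α)) := ⟨_, rfl⟩
  have hQI : ∫⁻ t in Ico 0 T, (∑ j ∈ Finset.Icc (-M : ℤ) M, ((2 : ℝ≥0∞) ^ (j / p : ℝ) *
      truncatedRearrangement M (duhamelMajorant n T f t) j) ^ 2) ^ (1 / (2 * α)) = ∫⁻ t, Q t := by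
    rw [← hI, ← hS, ← lintegral_indicator hIm]
    congr 1 with t
    rw [hQ]
    by_cases ht : t ∈ I
    · rw [indicator_of_mem ht]
      congr 1
      refine Finset.sum_congr rfl fun j hj => ?_
      rw [hvS j hj, indicator_of_mem ht, hL]
    · rw [indicator_of_notMem ht]
      dsimp only
      rw [Finset.sum_eq_zero fun j _ => by rw [hvI j t ht]; simp, ENNReal.zero_rpow_of_pos]
      positivity
  rw [hQI]
  have hQt : ∫⁻ t, Q t ≠ ∞ := by
    have : ∀ t, Q t ≤ I.indicator (fun _ => (∑ j ∈ S, K ^ 2) ^ (1 / (2 * α))) t := fun t => by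
      rw [hQ]
      by_cases ht : t ∈ I
      · rw [indicator_of_mem ht]
        refine ENNReal.rpow_le_rpow (Finset.sum_le_sum fun j _ => ?_) (by positivity)
        gcongr
        exact hvK j t
      · dsimp only
        rw [Finset.sum_eq_zero fun j _ => by rw [hvI j t ht]; simp, ENNReal.zero_rpow_of_pos]
        · exact zero_le
        · positivity
    refine ne_top_of_le_ne_top ?_ (lintegral_mono this)
    rw [lintegral_indicator hIm, setLIntegral_const]
    exact ENNReal.mul_ne_top (ENNReal.rpow_ne_top_of_nonneg (by positivity)
      (ENNReal.sum_ne_top.2 fun _ _ => ENNReal.pow_ne_top hKt)) hIt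
  refine rpow_le_of_le_mul_rpow hα0 hQt ?_
  rw [← hI]
  obtain ⟨Φ, hΦ⟩ : ∃ Φ : ℝ → ℝ → ℝ≥0∞, Φ = fun t τ => ∑ j ∈ S, dualCoeff p α S v j t *
      ∫⁻ x, W j t x * ‖schrodinger n (t - τ) (f τ) x‖ₑ := ⟨_, rfl⟩
  have hWs : ∀ j, Measurable fun q : (ℝ × ℝ) × Rn n =>
      W j q.1.1 q.2 * ‖schrodinger n (q.1.1 - q.1.2) (f q.1.2) q.2‖ₑ := fun j => by
    have h : Measurable fun q : (ℝ × ℝ) × Rn n => (q.1.1, q.2) := by fun_prop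
    exact ((hW j).comp h).mul (measurable_enorm_schrodinger hf)
  have hWi : ∀ j, Measurable fun q : ℝ × ℝ =>
      ∫⁻ x, W j q.1 x * ‖schrodinger n (q.1 - q.2) (f q.2) x‖ₑ := fun j =>
    (hWs j).lintegral_prod_right'
  have hΦm : Measurable fun q : ℝ × ℝ => Φ q.1 q.2 := by
    rw [hΦ]
    refine Finset.measurable_sum _ fun j _ => Measurable.fun_mul ?_ (hWi j)
    exact (measurable_dualCoeff hvm j).comp measurable_fst
  have hQΦ : ∀ t, Q t ≤ ∫⁻ τ in I, Φ t τ := fun t => by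
    rw [hQ]
    dsimp only
    rw [dualCoeff_mul_rpow hα0 hα' S hvS t, hΦ]
    dsimp only
    have hWit : ∀ j, Measurable fun τ => ∫⁻ x, W j t x * ‖schrodinger n (t - τ) (f τ) x‖ₑ :=
      fun j => (hWi j).comp measurable_prodMk_left
    rw [lintegral_finsetSum _ fun j _ => (hWit j).const_mul _]
    refine Finset.sum_le_sum fun j _ => ?_
    rw [lintegral_const_mul _ (hWit j)]
    gcongr
    refine (indicator_le_self _ _ t).trans ?_
    have hsw : Measurable fun q : ℝ × Rn n =>
        W j t q.2 * ‖schrodinger n (t - q.1) (f q.1) q.2‖ₑ := by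
      have h : Measurable fun q : ℝ × Rn n => ((t, q.1), q.2) := by fun_prop
      exact (hWs j).comp h
    rw [lintegral_lintegral_swap hsw.aemeasurable, hL]
    refine (hWG j t).trans (lintegral_mono fun x => ?_)
    rw [duhamelMajorant, ← hI, lintegral_const_mul' _ _ (hWt j t x)]
  have hΦτ : ∀ τ, ∫⁻ t, Φ t τ ≤ C * eLpNorm (f τ) 2 volume * (∫⁻ t, Q t) ^ (1 - α) ∨
      eLpNorm (f τ) 2 volume = ∞ := fun τ => by
    have hfτ : Measurable (f τ) := hf.comp measurable_prodMk_left
    by_cases h2 : eLpNorm (f τ) 2 volume = ∞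
    · exact .inr h2
    left
    by_cases h1 : Integrable (f τ)
    · rw [hΦ, hQ]
      exact hbound (f τ) hfτ h1 ⟨hfτ.aestronglyMeasurable, lt_top_iff_ne_top.2 h2⟩ τ
    · rw [hΦ]
      simp [schrodinger_of_not_integrable hfτ h1]
  have hnorm : AEMeasurable (fun τ => eLpNorm (f τ) 2 volume) (volume.restrict I) :=
    (measurable_eLpNorm_two hf).aemeasurable
  calc ∫⁻ t, Q t ≤ ∫⁻ t, ∫⁻ τ in I, Φ t τ := lintegral_mono hQΦ
    _ = ∫⁻ τ in I, ∫⁻ t, Φ t τ := lintegral_lintegral_swap hΦm.aemeasurable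
    _ ≤ ∫⁻ τ in I, C * eLpNorm (f τ) 2 volume * (∫⁻ t, Q t) ^ (1 - α) := by
        refine lintegral_mono_ae ?_
        filter_upwards [ae_lt_top' hnorm (hI ▸ hfin)] with τ hτ
        exact (hΦτ τ).resolve_right hτ.ne
    _ = C * (∫⁻ τ in I, eLpNorm (f τ) 2 volume) * (∫⁻ t, Q t) ^ (1 - α) := by
        rw [lintegral_mul_const'' _ (hnorm.const_mul _), lintegral_const_mul'' _ hnorm]

lemma monotone_sum_truncatedRearrangement {n : ℕ} (c : ℤ → ℝ≥0∞) (g : Rn n → ℝ≥0∞) :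
    Monotone fun M : ℕ =>
      ∑ j ∈ Finset.Icc (-M : ℤ) M, (c j * truncatedRearrangement M g j) ^ 2 := by
  intro M N h
  refine (Finset.sum_le_sum fun j _ => ?_).trans (Finset.sum_le_sum_of_subset
    (Finset.Icc_subset_Icc (by omega) (by omega)))
  gcongr
  exact truncatedRearrangement_mono g j h

lemma tsum_dyadicRearrangement_le_iSup {n : ℕ} (c : ℤ → ℝ≥0∞) (g : Rn n → ℝ≥0∞) :
    ∑' j, (c j * dyadicRearrangement volume g j) ^ 2 ≤
      ⨆ M : ℕ, ∑ j ∈ Finset.Icc (-M : ℤ) M, (c j * truncatedRearrangement M g j) ^ 2 := by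
  rw [ENNReal.tsum_eq_iSup_sum]
  refine iSup_le fun F => ?_
  have hmono : ∀ j, Monotone fun M => (c j * truncatedRearrangement M g j) ^ 2 :=
    fun j M N h => by
      dsimp only
      gcongr
      exact truncatedRearrangement_mono g j h
  calc _ ≤ ∑ j ∈ F, ⨆ M, (c j * truncatedRearrangement M g j) ^ 2 := by
        refine Finset.sum_le_sum fun j _ => ?_
        calc _ ≤ (c j * ⨆ M, truncatedRearrangement M g j) ^ 2 := by
              gcongr
              exact iSup_truncatedRearrangement g j
          _ = _ := by
              rw [ENNReal.mul_iSup, ENNReal.iSup_pow]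
    _ = ⨆ M, ∑ j ∈ F, (c j * truncatedRearrangement M g j) ^ 2 :=
        ENNReal.finsetSum_iSup_of_monotone hmono
    _ ≤ _ := by
        refine iSup_le fun M => ?_
        obtain ⟨N, hN⟩ : ∃ N : ℕ, ∀ j ∈ F, j.natAbs ≤ N :=
          ⟨F.sup Int.natAbs, fun j hj => Finset.le_sup (f := Int.natAbs) hj⟩
        refine le_iSup_of_le (max M N) ((Finset.sum_le_sum fun j _ =>
          hmono j (le_max_left M N)).trans (Finset.sum_le_sum_of_subset fun j hj => ?_))
        rw [Finset.mem_Icc]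
        have := hN j hj
        omega

lemma exists_timeNorm_duhamel_le {n : ℕ} {p α : ℝ} (hp : 2 < p)
    (hα : α = n / 2 * (1 / 2 - 1 / p)) (hα0 : 0 < α) (hα' : α < 1 / 2) :
    ∃ C : ℝ≥0∞, C ≠ ∞ ∧ ∀ (T : ℝ) (f : ℝ → Rn n → ℂ),
      Measurable (fun q : ℝ × Rn n => f q.1 q.2) →
      ∫⁻ τ in Ico 0 T, eLpNorm (f τ) 2 volume ≠ ∞ →
      timeNorm (gam n p) (Ico 0 T) (fun t => lornorm n p (duhamel n 0 f t)) ≤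
      C * ∫⁻ τ in Ico 0 T, eLpNorm (f τ) 2 volume := by
  obtain ⟨C, hC, hmain⟩ := exists_lintegral_truncated_le (n := n) hp hα hα0 hα'
  refine ⟨8 ^ (1 / 2 : ℝ) * C, ENNReal.mul_ne_top
    (ENNReal.rpow_ne_top_of_nonneg (by norm_num) (by norm_num)) hC, fun T f hf hfin => ?_⟩
  have hγ : gam n p = ENNReal.ofReal α⁻¹ := by
    rw [gam, ← hα, ENNReal.ofReal_inv_of_pos hα0]
  rw [timeNorm, if_neg (by rw [hγ]; exact ofReal_ne_top), hγ, ENNReal.toReal_ofReal (by positivity),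
    inv_inv]
  have he : (0 : ℝ) < 1 / (2 * α) := by positivity
  have hG := measurable_duhamelMajorant T hf
  obtain ⟨Q, hQ⟩ : ∃ Q : ℕ → ℝ → ℝ≥0∞, Q = fun (M : ℕ) t =>
      (∑ j ∈ Finset.Icc (-M : ℤ) M, ((2 : ℝ≥0∞) ^ (j / p : ℝ) *
        truncatedRearrangement M (duhamelMajorant n T f t) j) ^ 2) ^ (1 / (2 * α)) := ⟨_, rfl⟩
  have hQm : ∀ M, Measurable (Q M) := fun M => by
    rw [hQ]
    refine Measurable.pow_const (Finset.measurable_sum _ fun j _ => ?_) _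
    exact ((measurable_truncatedRearrangement hG M j).const_mul _).pow_const _
  have hQmono : Monotone Q := fun M N h t => by
    rw [hQ]
    exact ENNReal.rpow_le_rpow (monotone_sum_truncatedRearrangement _ _ h) he.le
  have hpt : ∀ t ∈ Ico 0 T, lornorm n p (duhamel n 0 f t) ^ α⁻¹ ≤
      8 ^ (1 / (2 * α)) * ⨆ M, Q M t := fun t ht => by
    have h := lornorm_sq_le hp.le (enorm_duhamel_le ht f)
    calc _ = (lornorm n p (duhamel n 0 f t) ^ 2) ^ (1 / (2 * α)) := by
          rw [← ENNReal.rpow_natCast, ← ENNReal.rpow_mul]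
          congr 1
          push_cast
          field_simp
      _ ≤ (8 * ⨆ M : ℕ, ∑ j ∈ Finset.Icc (-M : ℤ) M, ((2 : ℝ≥0∞) ^ (j / p : ℝ) *
            truncatedRearrangement M (duhamelMajorant n T f t) j) ^ 2) ^ (1 / (2 * α)) := by
          refine ENNReal.rpow_le_rpow (h.trans ?_) he.le
          gcongr
          exact tsum_dyadicRearrangement_le_iSup (fun j : ℤ => (2 : ℝ≥0∞) ^ (j / p : ℝ)) _
      _ = _ := by
          rw [ENNReal.mul_rpow_of_nonneg _ _ he.le]
          congr 1
          rw [hQ]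
          exact (ENNReal.orderIsoRpow _ he).map_iSup _
  calc _ ≤ (∫⁻ t in Ico 0 T, 8 ^ (1 / (2 * α)) * ⨆ M, Q M t) ^ α :=
        ENNReal.rpow_le_rpow (setLIntegral_mono' measurableSet_Ico hpt) hα0.le
    _ = (8 ^ (1 / (2 * α)) * ⨆ M, ∫⁻ t in Ico 0 T, Q M t) ^ α := by
        rw [lintegral_const_mul _ (.iSup hQm), lintegral_iSup hQm hQmono]
    _ = 8 ^ (1 / 2 : ℝ) * ⨆ M, (∫⁻ t in Ico 0 T, Q M t) ^ α := by
        rw [ENNReal.mul_rpow_of_nonneg _ _ hα0.le, ← ENNReal.rpow_mul]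
        congr 1
        · congr 1
          field_simp
        · exact (ENNReal.orderIsoRpow _ hα0).map_iSup _
    _ ≤ _ := by
        rw [mul_assoc]
        gcongr
        refine iSup_le fun M => ?_
        rw [hQ]
        exact hmain T f hf hfin M

lemma tsum_ite_two_zpow_lt_le (a : ℝ≥0∞) :
    ∑' k : ℤ, (if (2 : ℝ≥0∞) ^ k < a then (2 : ℝ≥0∞) ^ k else 0) ≤ 2 * a := by
  rcases eq_or_ne a ∞ with rfl | ha
  · simp
  lift a to NNReal using ha
  have h2 : ∀ k : ℤ, (2 : ℝ) ^ (k + 1) = 2 * 2 ^ k := fun k => by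
    rw [zpow_add₀ two_ne_zero]; ring
  have hmono : Monotone fun k : ℤ => (2 : ℝ) ^ k := zpow_right_mono₀ one_le_two
  have hdis : Pairwise fun i j : ℤ => Disjoint (if (2 : ℝ≥0∞) ^ i < a then
      Ico ((2 : ℝ) ^ i) (2 ^ (i + 1)) else ∅) (if (2 : ℝ≥0∞) ^ j < a then
      Ico ((2 : ℝ) ^ j) (2 ^ (j + 1)) else ∅) := fun i j hij => by
    have := hmono.pairwise_disjoint_on_Ico_succ hij
    dsimp only
    split_ifs
    · exact this
    all_goals simp
  calc _ = ∑' k : ℤ, volume (if (2 : ℝ≥0∞) ^ k < a then Ico ((2 : ℝ) ^ k) (2 ^ (k + 1)) else ∅) := by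
        congr 1 with k
        split_ifs
        · rw [Real.volume_Ico, h2, ← ofReal_two_zpow]
          congr 1; ring
        · simp
    _ = volume (⋃ k : ℤ, if (2 : ℝ≥0∞) ^ k < a then Ico ((2 : ℝ) ^ k) (2 ^ (k + 1)) else ∅) := by
        refine (measure_iUnion hdis fun k => ?_).symm
        split_ifs
        · exact measurableSet_Ico
        · exact .empty
    _ ≤ volume (Ico (0 : ℝ) (2 * a)) := by
        refine measure_mono (iUnion_subset fun k => ?_)
        split_ifs with hk
        · rw [← ofReal_two_zpow, ← ENNReal.ofReal_coe_nnreal,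
            ENNReal.ofReal_lt_ofReal_iff_of_nonneg (by positivity)] at hk
          refine Ico_subset_Ico (by positivity) ?_
          rw [h2]
          linarith
        · exact empty_subset _
    _ = 2 * a := by
        rw [Real.volume_Ico, sub_zero, ENNReal.ofReal_mul (by norm_num), ENNReal.ofReal_coe_nnreal]
        simp

lemma tsum_dyadicRearrangement_sq_le {α : Type*} [MeasurableSpace α] {μ : Measure α}
    {g : α → ℝ≥0∞} (hg : Measurable g) :
    ∑' j : ℤ, ((2 : ℝ≥0∞) ^ (j / 2 : ℝ) * dyadicRearrangement μ g j) ^ 2 ≤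
      4 * ∫⁻ x, g x ^ 2 ∂μ := by
  obtain ⟨D, hD⟩ : ∃ D : ℤ → ℝ≥0∞, D = fun k => μ {x | (2 : ℝ≥0∞) ^ k < g x} := ⟨_, rfl⟩
  have hms : ∀ k : ℤ, MeasurableSet {x | (2 : ℝ≥0∞) ^ k < g x} := fun k =>
    measurableSet_lt measurable_const hg
  calc _ ≤ ∑' j : ℤ, ∑' k : ℤ,
        ((2 : ℝ≥0∞) ^ k) ^ 2 * (if (2 : ℝ≥0∞) ^ j < D k then 2 ^ j else 0) := by
        refine ENNReal.tsum_le_tsum fun j => ?_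
        have hj : ((2 : ℝ≥0∞) ^ (j / 2 : ℝ)) ^ 2 = 2 ^ j := by
          rw [← ENNReal.rpow_natCast, ← ENNReal.rpow_mul, ← ENNReal.rpow_intCast]
          congr 1; push_cast; ring
        rw [mul_pow, hj, dyadicRearrangement, ENNReal.iSup_pow, ENNReal.mul_iSup]
        refine iSup_le fun k => le_trans (le_of_eq ?_) (ENNReal.le_tsum k)
        rw [hD]
        dsimp only
        split_ifs
        · rw [mul_comm]
        · simp
    _ = ∑' k : ℤ, ((2 : ℝ≥0∞) ^ k) ^ 2 *
        ∑' j : ℤ, (if (2 : ℝ≥0∞) ^ j < D k then (2 : ℝ≥0∞) ^ j else 0) := by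
        rw [ENNReal.tsum_comm]
        simp_rw [ENNReal.tsum_mul_left]
    _ ≤ ∑' k : ℤ, ((2 : ℝ≥0∞) ^ k) ^ 2 * (2 * D k) := by
        gcongr with k
        exact tsum_ite_two_zpow_lt_le _
    _ = 2 * ∑' k : ℤ, ∫⁻ x, {x | (2 : ℝ≥0∞) ^ k < g x}.indicator
          (fun _ => ((2 : ℝ≥0∞) ^ k) ^ 2) x ∂μ := by
        rw [← ENNReal.tsum_mul_left]
        congr 1 with k
        rw [lintegral_indicator_const (hms k), hD]
        ring
    _ = 2 * ∫⁻ x, ∑' k : ℤ, {x | (2 : ℝ≥0∞) ^ k < g x}.indicator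
          (fun _ => ((2 : ℝ≥0∞) ^ k) ^ 2) x ∂μ := by
        rw [lintegral_tsum fun k => (measurable_const.indicator (hms k)).aemeasurable]
    _ ≤ 2 * ∫⁻ x, 2 * g x ^ 2 ∂μ := by
        gcongr with x
        calc _ ≤ ∑' k : ℤ, (if (2 : ℝ≥0∞) ^ k < g x then (2 : ℝ≥0∞) ^ k else 0) * g x := by
              refine ENNReal.tsum_le_tsum fun k => ?_
              simp only [indicator_apply, mem_ofPred]
              split_ifs with hk
              · rw [pow_two]
                gcongr
              · exact zero_le
          _ ≤ 2 * g x * g x := by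
              rw [ENNReal.tsum_mul_right]
              gcongr
              exact tsum_ite_two_zpow_lt_le _
          _ = _ := by ring
    _ = _ := by
        rw [lintegral_const_mul _ (hg.pow_const 2), ← mul_assoc]
        norm_num

lemma lintegral_lintegral_sq_le {α β : Type*} [MeasurableSpace α] [MeasurableSpace β]
    {μ : Measure α} {ν : Measure β} [SFinite μ] [SFinite ν] {a : α → β → ℝ≥0∞} {N : α → ℝ≥0∞}
    (ha : Measurable fun q : α × β => a q.1 q.2) (hN : Measurable N)
    (haN : ∀ᵐ τ ∂μ, (∫⁻ x, a τ x ^ 2 ∂ν) ^ (1 / 2 : ℝ) ≤ N τ) :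
    ∫⁻ x, (∫⁻ τ, a τ x ∂μ) ^ 2 ∂ν ≤ (∫⁻ τ, N τ ∂μ) ^ 2 := by
  have hax : ∀ x, Measurable fun τ => a τ x := fun x => ha.comp measurable_prodMk_right
  have haτ : ∀ τ, Measurable (a τ) := fun τ => ha.comp measurable_prodMk_left
  have h3 : Measurable fun q : (α × α) × β => a q.1.1 q.2 * a q.1.2 q.2 :=
    (ha.comp (by fun_prop : Measurable fun q : (α × α) × β => (q.1.1, q.2))).mul
      (ha.comp (by fun_prop : Measurable fun q : (α × α) × β => (q.1.2, q.2)))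
  calc _ = ∫⁻ x, ∫⁻ τ, ∫⁻ σ, a τ x * a σ x ∂μ ∂μ ∂ν := by
        congr 1 with x
        simp_rw [lintegral_const_mul _ (hax x)]
        rw [lintegral_mul_const _ (hax x), pow_two]
    _ = ∫⁻ x, ∫⁻ r, a r.1 x * a r.2 x ∂(μ.prod μ) ∂ν := by
        congr 1 with x
        have h : Measurable fun r : α × α => a r.1 x * a r.2 x := h3.comp measurable_prodMk_right
        rw [lintegral_prod _ h.aemeasurable]
    _ = ∫⁻ r, ∫⁻ x, a r.1 x * a r.2 x ∂ν ∂(μ.prod μ) := by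
        rw [lintegral_lintegral_swap]
        exact (h3.comp measurable_swap).aemeasurable
    _ = ∫⁻ τ, ∫⁻ σ, ∫⁻ x, a τ x * a σ x ∂ν ∂μ ∂μ := by
        rw [lintegral_prod _ h3.lintegral_prod_right'.aemeasurable]
    _ ≤ ∫⁻ τ, ∫⁻ σ, N τ * N σ ∂μ ∂μ := by
        refine lintegral_mono_ae (haN.mono fun τ hτ => lintegral_mono_ae (haN.mono fun σ hσ => ?_))
        refine le_trans (ENNReal.lintegral_mul_le_Lp_mul_Lq ν Real.HolderConjugate.two_two
          (haτ τ).aemeasurable (haτ σ).aemeasurable) ?_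
        simp only [ENNReal.rpow_ofNat]
        gcongr
    _ = _ := by
        simp_rw [lintegral_const_mul _ hN]
        rw [lintegral_mul_const _ hN, pow_two]

lemma lintegral_enorm_schrodinger_sq_le {n : ℕ} {r : ℝ} (hr : r ≠ 0) {g : Rn n → ℂ}
    (hg : Measurable g) (hg₁ : Integrable g) (hg₂ : MemLp g 2) :
    (∫⁻ x, ‖schrodinger n r g x‖ₑ ^ 2) ^ (1 / 2 : ℝ) ≤ eLpNorm g 2 volume := by
  obtain ⟨z, hz⟩ : ∃ z, z = schrodinger n r g := ⟨_, rfl⟩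
  have hzm : Measurable z := by
    have h : Measurable fun x : Rn n => (r, x) := by fun_prop
    rw [hz]
    simpa only [Function.comp_def, sub_zero] using (measurable_schrodinger_sub_const hg 0).comp h
  obtain ⟨B, hB⟩ : ∃ B, B = ENNReal.ofReal (|r| ^ (-(n / 2 : ℝ))) * eLpNorm g 1 volume := ⟨_, rfl⟩
  have hBt : B ≠ ∞ := by
    rw [hB]
    exact ENNReal.mul_ne_top ofReal_ne_top (memLp_one_iff_integrable.2 hg₁).2.ne
  have hzB : ∀ x, ‖z x‖ₑ ≤ B := fun x => by
    rw [hz, hB]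
    exact enorm_schrodinger_le hr g x
  have hball : ∀ R : ℕ, (∫⁻ x in Metric.ball 0 R, ‖z x‖ₑ ^ 2) ^ (1 / 2 : ℝ) ≤
      eLpNorm g 2 volume := fun R => by
    obtain ⟨b, hb⟩ : ∃ b : Set (Rn n), b = Metric.ball 0 R := ⟨_, rfl⟩
    rw [← hb]
    have hbm : MeasurableSet b := hb ▸ Metric.isOpen_ball.measurableSet
    have hbt : volume b < ∞ := hb ▸ Metric.isBounded_ball.measure_lt_top
    have hA : ∫⁻ x in b, ‖z x‖ₑ ^ 2 ≠ ∞ := by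
      refine ne_top_of_le_ne_top ?_ (setLIntegral_mono' hbm fun x _ =>
        pow_le_pow_left' (hzB x) 2)
      rw [setLIntegral_const]
      exact ENNReal.mul_ne_top (ENNReal.pow_ne_top hBt) hbt.ne
    have hh₂ : MemLp (b.indicator z) 2 := by
      rw [memLp_indicator_iff_restrict hbm]
      refine ⟨hzm.aestronglyMeasurable, ?_⟩
      rw [eLpNorm_lt_top_iff_lintegral_rpow_enorm_lt_top two_ne_zero ofNat_ne_top]
      simpa using hA.lt_top
    have hh₁ : Integrable (b.indicator z) := by
      rw [integrable_indicator_iff hbm]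
      refine ⟨hzm.aestronglyMeasurable, lt_of_le_of_lt (lintegral_mono hzB) ?_⟩
      rw [setLIntegral_const]
      exact ENNReal.mul_lt_top hBt.lt_top hbt
    have hnorm : eLpNorm (b.indicator z) 2 volume = (∫⁻ x in b, ‖z x‖ₑ ^ 2) ^ (1 / 2 : ℝ) := by
      rw [eLpNorm_indicator_eq_eLpNorm_restrict hbm,
        eLpNorm_eq_lintegral_rpow_enorm_toReal two_ne_zero ofNat_ne_top]
      simp
    have hinner : ∀ x, conj (schrodinger n (r - 0) g x) * b.indicator z x =
        ((b.indicator (fun x => ‖z x‖ ^ 2) x : ℝ) : ℂ) := fun x => by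
      rw [sub_zero, ← hz]
      by_cases hx : x ∈ b
      · simp [hx, Complex.conj_mul']
      · simp [hx]
    have hle := (enorm_inner_freeEvolution_le hr.symm hg₁ hg₂ hh₁ hh₂).trans (min_le_left _ _)
    rw [inner_freeEvolution hr.symm hg₁ hg₂ hh₁ hh₂] at hle
    simp_rw [hinner] at hle
    rw [integral_complex_ofReal, ← ofReal_norm, Complex.norm_real, Real.norm_eq_abs, abs_of_nonneg
      (integral_nonneg fun x => indicator_nonneg (fun _ _ => by positivity) x),
      integral_indicator hbm, ofReal_integral_eq_lintegral_ofReal _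
      (.of_forall fun x => by positivity), hnorm] at hle
    · refine rpow_le_of_le_mul_rpow (by norm_num) hA ?_
      refine le_trans (le_of_eq ?_) (hle.trans_eq (by norm_num))
      congr 1 with x
      rw [ENNReal.ofReal_pow (norm_nonneg _), ofReal_norm]
    · refine ⟨by fun_prop, ?_⟩
      rw [hasFiniteIntegral_iff_ofReal (.of_forall fun x => by positivity)]
      simpa only [ENNReal.ofReal_pow (norm_nonneg _), ofReal_norm] using hA.lt_top
  have hmono : Monotone fun R : ℕ => Metric.ball (0 : Rn n) R := fun a b hab =>
    Metric.ball_subset_ball (by exact_mod_cast hab)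
  rw [← hz, ← setLIntegral_univ, ← Metric.iUnion_ball_nat (0 : Rn n),
    setLIntegral_iUnion_of_directed _ hmono.directed_le]
  calc _ = ⨆ R : ℕ, (∫⁻ x in Metric.ball 0 R, ‖z x‖ₑ ^ 2) ^ (1 / 2 : ℝ) :=
        (ENNReal.orderIsoRpow _ (by norm_num : (0 : ℝ) < 1 / 2)).map_iSup _
    _ ≤ _ := iSup_le hball

lemma lornorm_two_duhamel_le {n : ℕ} {T : ℝ} {f : ℝ → Rn n → ℂ}
    (hf : Measurable fun q : ℝ × Rn n => f q.1 q.2) {t : ℝ} (ht : t ∈ Ico 0 T) :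
    lornorm n 2 (duhamel n 0 f t) ≤ 6 * ∫⁻ τ in Ico 0 T, eLpNorm (f τ) 2 volume := by
  have hG : Measurable (duhamelMajorant n T f t) := by
    have h : Measurable fun x : Rn n => (t, x) := by fun_prop
    simpa only [Function.comp_def] using (measurable_duhamelMajorant T hf).comp h
  have ha : Measurable fun q : ℝ × Rn n => ‖schrodinger n (t - q.1) (f q.1) q.2‖ₑ := by
    have h : Measurable fun q : ℝ × Rn n => ((t, q.1), q.2) := by fun_prop
    simpa only [Function.comp_def] using (measurable_enorm_schrodinger hf).comp h
  have hsq : ∫⁻ x, duhamelMajorant n T f t x ^ 2 ≤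
      (∫⁻ τ in Ico 0 T, eLpNorm (f τ) 2 volume) ^ 2 := by
    refine lintegral_lintegral_sq_le ha (measurable_eLpNorm_two hf)
      (ae_restrict_of_ae ((volume.ae_ne t).mono fun τ hτ => ?_))
    have hfτ : Measurable (f τ) := hf.comp measurable_prodMk_left
    by_cases h₂ : eLpNorm (f τ) 2 volume = ∞
    · rw [h₂]
      exact le_top
    by_cases h₁ : Integrable (f τ)
    · exact lintegral_enorm_schrodinger_sq_le (sub_ne_zero.2 hτ.symm) hfτ h₁
        ⟨hfτ.aestronglyMeasurable, lt_top_iff_ne_top.2 h₂⟩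
    · simp [schrodinger_of_not_integrable hfτ h₁]
  refine (ENNReal.pow_right_strictMono two_ne_zero).le_iff_le.1 ?_
  calc _ ≤ _ := lornorm_sq_le le_rfl (enorm_duhamel_le ht f)
    _ ≤ 8 * (4 * (∫⁻ τ in Ico 0 T, eLpNorm (f τ) 2 volume) ^ 2) := by
        gcongr
        exact (tsum_dyadicRearrangement_sq_le hG).trans (by gcongr)
    _ ≤ _ := by
        rw [mul_pow, ← mul_assoc]
        gcongr
        norm_num

end

/-- `L¹`-`L²` inhomogeneous estimate:
`‖A_S f‖_{L^{γ(p)}([0,T), L^{p,2})} ≲ ‖f‖_{L¹([0,T), L²)}` for `2 ≤ p < 2*`. -/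
theorem L1_L2_inhomogeneous_estimate (n : ℕ) (hn : 1 ≤ n) (p : ℝ) (hp : subcrit n p) :
    ∃ C : ℝ≥0∞, C < ∞ ∧ ∀ T : ℝ, ∀ f : ℝ → Rn n → ℂ,
      Measurable (fun q : ℝ × Rn n => f q.1 q.2) →
      timeNorm (gam n p) (Ico (0:ℝ) T) (fun t => lornorm n p (duhamel n 0 f t)) ≤
        C * ∫⁻ t in Ico (0:ℝ) T, eLpNorm (f t) 2 volume := by
  rcases hp.1.eq_or_lt with rfl | hp2
  · refine ⟨6, by norm_num, fun T f hf => ?_⟩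
    have hγ : gam n 2 = ∞ := by simp [gam]
    rw [timeNorm, if_pos hγ]
    refine essSup_le_of_ae_le _ ?_
    filter_upwards [ae_restrict_mem measurableSet_Ico] with t ht
    exact lornorm_two_duhamel_le hf ht
  · have hn0 : (0 : ℝ) < n := by exact_mod_cast hn
    have hp' : 0 < 1 / 2 - 1 / p := sub_pos.2 (one_div_lt_one_div_of_lt two_pos hp2)
    have hα' : (n : ℝ) / 2 * (1 / 2 - 1 / p) < 1 / 2 := by
      have hp0 : 0 < p := by linarith
      have hpi : 0 < 1 / p := by positivity
      by_cases h3 : 3 ≤ n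
      · have h3' : (0 : ℝ) < n - 2 := by
          have : (3 : ℝ) ≤ n := by exact_mod_cast h3
          linarith
        have h := hp.2 h3
        rw [lt_div_iff₀ h3'] at h
        have : (n - 2 : ℝ) < 2 * n * (1 / p) := by
          rw [mul_one_div, lt_div_iff₀ hp0]
          linarith
        linarith
      · have : (n : ℝ) ≤ 2 := by exact_mod_cast (by omega : n ≤ 2)
        nlinarith
    obtain ⟨C, hC, hmain⟩ := exists_timeNorm_duhamel_le hp2 rfl (by positivity) hα'
    refine ⟨C + 1, ENNReal.add_lt_top.2 ⟨hC.lt_top, one_lt_top⟩, fun T f hf => ?_⟩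
    by_cases hfin : ∫⁻ τ in Ico 0 T, eLpNorm (f τ) 2 volume = ∞
    · rw [hfin, ENNReal.mul_top (by simp)]
      exact le_top
    · exact (hmain T f hf hfin).trans (by gcongr; exact le_self_add)
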